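/- There exists a constant C ≥ 1, depending only on T, α, β, K and δ, such that for every classical solution (v,u,θ,w,b) of the planar compressible MHD system on ℝ × [0,T] with (K,δ)-admissible initial data, one has C⁻¹ ≤ v(x,t) ≤ C for all (x,t) ∈ ℝ × [0,T]. -/

import Mathlib

open MeasureTheory Set Filter

noncomputable section

/-- Viscosity function `μ(z) = 1 + α z^(−α)` (here `μ̃₁ = 1`, `μ̃₂ = α`). -/
def visc (α z : ℝ) : ℝ := 1 + α * z ^ (-α)

/-- Squared Euclidean norm on `ℝ × ℝ` (used for the transverse fields `w, b ∈ ℝ²`). -/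
def sq2 (p : ℝ × ℝ) : ℝ := p.1 ^ 2 + p.2 ^ 2

/-- Partial derivative with respect to the first (spatial) variable. -/
def pdx {E : Type*} [NormedAddCommGroup E] [NormedSpace ℝ E]
    (f : ℝ → ℝ → E) (x t : ℝ) : E := deriv (fun y => f y t) x

/-- Partial derivative with respect to the second (time) variable, taken within `[0, T]`
(so it is one-sided at the endpoints). -/
def pdt (T : ℝ) {E : Type*} [NormedAddCommGroup E] [NormedSpace ℝ E]
    (f : ℝ → ℝ → E) (x t : ℝ) : E := derivWithin (fun s => f x s) (Icc 0 T) t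

/-- A classical solution of the planar compressible MHD system (in Lagrangian coordinates,
with all physical constants normalized to `1` and `μ̃₂ = α`) on `ℝ × [0,T]`:
all the derivatives appearing in the equations exist and are continuous, `v, θ > 0`,
the five equations hold pointwise, the solution tends to `(1,0,1,0,0)` as `|x| → ∞`
uniformly in `t ∈ [0,T]`, and `v−1, u, θ−1, b, w` and their first spatial derivatives
are square-integrable in `x` for each `t ∈ [0,T]`. -/
structure IsClassicalSolution (α β T : ℝ) (v u θ : ℝ → ℝ → ℝ)
    (w b : ℝ → ℝ → ℝ × ℝ) : Prop where
  v_pos : ∀ x : ℝ, ∀ t ∈ Icc (0:ℝ) T, 0 < v x t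
  θ_pos : ∀ x : ℝ, ∀ t ∈ Icc (0:ℝ) T, 0 < θ x t
  diff_x : ∀ x : ℝ, ∀ t ∈ Icc (0:ℝ) T,
    DifferentiableAt ℝ (fun y => v y t) x ∧ DifferentiableAt ℝ (fun y => u y t) x ∧
    DifferentiableAt ℝ (fun y => θ y t) x ∧ DifferentiableAt ℝ (fun y => w y t) x ∧
    DifferentiableAt ℝ (fun y => b y t) x
  diff_xx : ∀ x : ℝ, ∀ t ∈ Icc (0:ℝ) T,
    DifferentiableAt ℝ (fun y => pdx u y t) x ∧ DifferentiableAt ℝ (fun y => pdx θ y t) x ∧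
    DifferentiableAt ℝ (fun y => pdx w y t) x ∧ DifferentiableAt ℝ (fun y => pdx b y t) x
  diff_t : ∀ x : ℝ, ∀ t ∈ Icc (0:ℝ) T,
    DifferentiableWithinAt ℝ (fun s => v x s) (Icc 0 T) t ∧
    DifferentiableWithinAt ℝ (fun s => u x s) (Icc 0 T) t ∧
    DifferentiableWithinAt ℝ (fun s => θ x s) (Icc 0 T) t ∧
    DifferentiableWithinAt ℝ (fun s => w x s) (Icc 0 T) t ∧
    DifferentiableWithinAt ℝ (fun s => b x s) (Icc 0 T) t
  cont : ContinuousOn (fun p : ℝ × ℝ =>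
      (v p.1 p.2, u p.1 p.2, θ p.1 p.2, w p.1 p.2, b p.1 p.2)) (univ ×ˢ Icc 0 T)
  cont_dx : ContinuousOn (fun p : ℝ × ℝ =>
      (pdx v p.1 p.2, pdx u p.1 p.2, pdx θ p.1 p.2, pdx w p.1 p.2, pdx b p.1 p.2))
      (univ ×ˢ Icc 0 T)
  cont_dxx : ContinuousOn (fun p : ℝ × ℝ =>
      (pdx (pdx u) p.1 p.2, pdx (pdx θ) p.1 p.2, pdx (pdx w) p.1 p.2, pdx (pdx b) p.1 p.2))
      (univ ×ˢ Icc 0 T)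
  cont_dt : ContinuousOn (fun p : ℝ × ℝ =>
      (pdt T v p.1 p.2, pdt T u p.1 p.2, pdt T θ p.1 p.2, pdt T w p.1 p.2, pdt T b p.1 p.2))
      (univ ×ˢ Icc 0 T)
  eq_mass : ∀ x : ℝ, ∀ t ∈ Icc (0:ℝ) T, pdt T v x t = pdx u x t
  eq_mom : ∀ x : ℝ, ∀ t ∈ Icc (0:ℝ) T,
    pdt T u x t + pdx (fun y s => θ y s / v y s + sq2 (b y s) / 2) x t
      = pdx (fun y s => visc α (v y s) * pdx u y s / v y s) x t
  eq_w : ∀ x : ℝ, ∀ t ∈ Icc (0:ℝ) T,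
    pdt T w x t - pdx b x t = pdx (fun y s => (v y s)⁻¹ • pdx w y s) x t
  eq_b : ∀ x : ℝ, ∀ t ∈ Icc (0:ℝ) T,
    pdt T (fun y s => v y s • b y s) x t - pdx w x t
      = pdx (fun y s => (v y s)⁻¹ • pdx b y s) x t
  eq_temp : ∀ x : ℝ, ∀ t ∈ Icc (0:ℝ) T,
    pdt T θ x t + θ x t / v x t * pdx u x t
      = pdx (fun y s => θ y s ^ β * pdx θ y s / v y s) x t
        + (visc α (v x t) * pdx u x t ^ 2 + sq2 (pdx w x t) + sq2 (pdx b x t)) / v x t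
  farfield : ∀ ε > (0:ℝ), ∃ M : ℝ, ∀ x : ℝ, ∀ t ∈ Icc (0:ℝ) T, M ≤ |x| →
    |v x t - 1| < ε ∧ |u x t| < ε ∧ |θ x t - 1| < ε ∧
    Real.sqrt (sq2 (b x t)) < ε ∧ Real.sqrt (sq2 (w x t)) < ε
  sq_int : ∀ t ∈ Icc (0:ℝ) T,
    Integrable (fun x => (v x t - 1) ^ 2) ∧ Integrable (fun x => (u x t) ^ 2) ∧
    Integrable (fun x => (θ x t - 1) ^ 2) ∧ Integrable (fun x => sq2 (b x t)) ∧
    Integrable (fun x => sq2 (w x t)) ∧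
    Integrable (fun x => (pdx v x t) ^ 2) ∧ Integrable (fun x => (pdx u x t) ^ 2) ∧
    Integrable (fun x => (pdx θ x t) ^ 2) ∧ Integrable (fun x => sq2 (pdx b x t)) ∧
    Integrable (fun x => sq2 (pdx w x t))

/-- The initial data of a solution are `(K, δ)`-admissible: the `H¹`-type norm of
`(v₀−1, u₀, θ₀−1, b₀, w₀)` is at most `K²` and `v₀ ≥ δ`, `θ₀ ≥ δ`. -/
def Admissible (K δ : ℝ) (v u θ : ℝ → ℝ → ℝ) (w b : ℝ → ℝ → ℝ × ℝ) : Prop :=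
  (∫ x : ℝ, ((v x 0 - 1) ^ 2 + (u x 0) ^ 2 + (θ x 0 - 1) ^ 2 + sq2 (b x 0) + sq2 (w x 0)
      + (pdx v x 0) ^ 2 + (pdx u x 0) ^ 2 + (pdx θ x 0) ^ 2
      + sq2 (pdx b x 0) + sq2 (pdx w x 0))) ≤ K ^ 2 ∧
  (∀ x : ℝ, δ ≤ v x 0) ∧ (∀ x : ℝ, δ ≤ θ x 0)

/-! ### Calculus on rectangles -/

theorem integral_swap_of_continuous {f : ℝ × ℝ → ℝ} (hf : Continuous f) (a b c d : ℝ) :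
    ∫ x in a..b, ∫ s in c..d, f (x, s) = ∫ s in c..d, ∫ x in a..b, f (x, s) := by
  apply MeasureTheory.intervalIntegral_intervalIntegral_swap (F := fun x s => f (x, s))
  exact (hf.continuousOn.integrableOn_compact (isCompact_uIcc.prod isCompact_uIcc)).mono_set
    (prod_mono uIoc_subset_uIcc uIoc_subset_uIcc)

theorem sq_integral_mul_le {f g : ℝ → ℝ} (hf : Continuous f) (hg : Continuous g) {a b : ℝ}
    (hab : a ≤ b) :
    (∫ x in a..b, f x * g x) ^ 2 ≤ (∫ x in a..b, f x ^ 2) * ∫ x in a..b, g x ^ 2 := by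
  have key : ∀ r : ℝ, 0 ≤ (∫ x in a..b, f x ^ 2) * (r * r)
      + (2 * ∫ x in a..b, f x * g x) * r + ∫ x in a..b, g x ^ 2 := by
    intro r
    have h0 : 0 ≤ ∫ x in a..b, (r * f x + g x) ^ 2 :=
      intervalIntegral.integral_nonneg hab fun x _ => sq_nonneg _
    have h1 : ∫ x in a..b, (r * f x + g x) ^ 2 = ∫ x in a..b,
        ((r * r) * f x ^ 2 + (2 * r) * (f x * g x) + g x ^ 2) := by
      congr 1; ext x; ring
    rw [h1, intervalIntegral.integral_add, intervalIntegral.integral_add,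
      intervalIntegral.integral_const_mul, intervalIntegral.integral_const_mul] at h0
    · linarith
    all_goals exact Continuous.intervalIntegrable (by fun_prop) _ _
  have h := discrim_le_zero key
  unfold discrim at h
  nlinarith

theorem le_mul_exp_of_le_add_integral {Y : ℝ → ℝ} (hY : Continuous Y) {A B T : ℝ}
    (hB : 0 ≤ B) (h : ∀ t ∈ Icc 0 T, Y t ≤ A + B * ∫ s in (0 : ℝ)..t, Y s) :
    ∀ t ∈ Icc 0 T, Y t ≤ A * Real.exp (B * t) := by
  set W : ℝ → ℝ := fun t => (A + B * ∫ s in (0 : ℝ)..t, Y s) * Real.exp (-(B * t)) with hW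
  have hd : ∀ t, HasDerivAt W ((B * Y t) * Real.exp (-(B * t))
      + (A + B * ∫ s in (0 : ℝ)..t, Y s) * (Real.exp (-(B * t)) * -B)) t := by
    intro t
    have h1 : HasDerivAt (fun t => A + B * ∫ s in (0 : ℝ)..t, Y s) (B * Y t) t :=
      ((intervalIntegral.integral_hasDerivAt_right (hY.intervalIntegrable _ _)
        (hY.stronglyMeasurableAtFilter _ _) hY.continuousAt).const_mul B).const_add A
    have h2 : HasDerivAt (fun t : ℝ => Real.exp (-(B * t))) (Real.exp (-(B * t)) * -B) t := by
      simpa using (((hasDerivAt_id t).const_mul B).neg).exp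
    exact h1.mul h2
  have hanti : AntitoneOn W (Icc 0 T) := by
    apply antitoneOn_of_deriv_nonpos (convex_Icc 0 T)
    · exact fun t _ => (hd t).continuousAt.continuousWithinAt
    · exact fun t _ => (hd t).differentiableAt.differentiableWithinAt
    · intro t ht
      rw [interior_Icc] at ht
      rw [(hd t).deriv]
      have := h t ⟨ht.1.le, ht.2.le⟩
      have e := Real.exp_pos (-(B * t))
      have : B * Real.exp (-(B * t)) * (Y t - (A + B * ∫ s in (0 : ℝ)..t, Y s)) ≤ 0 :=
        mul_nonpos_of_nonneg_of_nonpos (by positivity) (by linarith)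
      linarith
  intro t ht
  have h0 : W t ≤ W 0 := hanti ⟨le_rfl, ht.1.trans ht.2⟩ ht ht.1
  have h1 : W 0 = A := by simp [hW]
  have h2 : (A + B * ∫ s in (0 : ℝ)..t, Y s) = W t * Real.exp (B * t) := by
    simp only [hW]; rw [mul_assoc, ← Real.exp_add]; simp
  calc Y t ≤ _ := h t ht
    _ = W t * Real.exp (B * t) := h2
    _ ≤ A * Real.exp (B * t) := by
      rw [← h1]; gcongr

theorem sub_eq_integral_time {η ηt : ℝ × ℝ → ℝ} (hη : Continuous η) (hηt : Continuous ηt)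
    {T : ℝ} (hd : ∀ x, ∀ s ∈ Ioo 0 T, HasDerivAt (fun r => η (x, r)) (ηt (x, s)) s)
    (x : ℝ) {t : ℝ} (ht : t ∈ Icc 0 T) :
    η (x, t) - η (x, 0) = ∫ s in (0 : ℝ)..t, ηt (x, s) :=
  (intervalIntegral.integral_eq_sub_of_hasDerivAt_of_le ht.1 (by fun_prop)
    (fun s hs => hd x s ⟨hs.1, hs.2.trans_le ht.2⟩)
    (Continuous.intervalIntegrable (by fun_prop) _ _)).symm

/-- Weak form on `[a, b] × [0, t]` of the balance law `ηₜ = Jₓ + S`, tested with `χ`. -/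
theorem balance_law_weak_form {η ηt J S : ℝ × ℝ → ℝ} {χ χ' : ℝ → ℝ}
    (hη : Continuous η) (hηt : Continuous ηt) (hJ : Continuous J) (hS : Continuous S)
    (hχ : ∀ x, HasDerivAt χ (χ' x) x) (hχ' : Continuous χ') {T : ℝ}
    (hd : ∀ x, ∀ s ∈ Ioo 0 T, HasDerivAt (fun r => η (x, r)) (ηt (x, s)) s)
    (hx : ∀ x s, HasDerivAt (fun y => J (y, s)) (ηt (x, s) - S (x, s)) x)
    (a b : ℝ) {t : ℝ} (ht : t ∈ Icc 0 T) :
    (∫ x in a..b, χ x * η (x, t)) - ∫ x in a..b, χ x * η (x, 0)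
      = ∫ s in (0 : ℝ)..t, (χ b * J (b, s) - χ a * J (a, s)
          + ∫ x in a..b, (χ x * S (x, s) - χ' x * J (x, s))) := by
  have hχc : Continuous χ := continuous_iff_continuousAt.2 fun x => (hχ x).continuousAt
  rw [← intervalIntegral.integral_sub (Continuous.intervalIntegrable (by fun_prop) _ _)
    (Continuous.intervalIntegrable (by fun_prop) _ _)]
  have h1 : ∀ x, χ x * η (x, t) - χ x * η (x, 0) = ∫ s in (0 : ℝ)..t, χ x * ηt (x, s) := by
    intro x
    rw [← mul_sub, sub_eq_integral_time hη hηt hd x ht, intervalIntegral.integral_const_mul]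
  simp_rw [h1]
  rw [integral_swap_of_continuous (f := fun p => χ p.1 * ηt p) (by fun_prop)]
  congr 1; ext s
  have h2 := intervalIntegral.integral_mul_deriv_eq_deriv_mul (a := a) (b := b)
    (fun x _ => hχ x) (fun x _ => hx x s)
    (Continuous.intervalIntegrable (by fun_prop) _ _)
    (Continuous.intervalIntegrable (by fun_prop) _ _)
  have h3 : ∫ x in a..b, χ x * ηt (x, s) = (∫ x in a..b, χ x * (ηt (x, s) - S (x, s)))
      + ∫ x in a..b, χ x * S (x, s) := by
    rw [← intervalIntegral.integral_add]
    · congr 1; ext x; ring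
    all_goals exact Continuous.intervalIntegrable (by fun_prop) _ _
  dsimp only
  rw [h3, h2, intervalIntegral.integral_sub]
  · ring
  all_goals exact Continuous.intervalIntegrable (by fun_prop) _ _

/-! ### The system in components -/

/-- A classical solution in scalar components, extended to all times by freezing it outside
`[0, T]`, together with its derivatives. -/
structure MHDFlow (α β T : ℝ) where
  (v u θ w₁ w₂ b₁ b₂ : ℝ × ℝ → ℝ)
  (ux θx w₁x w₂x b₁x b₂x : ℝ × ℝ → ℝ)
  (ut θt w₁t w₂t b₁t b₂t : ℝ × ℝ → ℝ)
  v_pos : ∀ p, 0 < v p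
  θ_pos : ∀ p, 0 < θ p
  cont_v : Continuous v
  cont_u : Continuous u
  cont_θ : Continuous θ
  cont_w₁ : Continuous w₁
  cont_w₂ : Continuous w₂
  cont_b₁ : Continuous b₁
  cont_b₂ : Continuous b₂
  cont_ux : Continuous ux
  cont_θx : Continuous θx
  cont_w₁x : Continuous w₁x
  cont_w₂x : Continuous w₂x
  cont_b₁x : Continuous b₁x
  cont_b₂x : Continuous b₂x
  cont_ut : Continuous ut
  cont_θt : Continuous θt
  cont_w₁t : Continuous w₁t
  cont_w₂t : Continuous w₂t
  cont_b₁t : Continuous b₁t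
  cont_b₂t : Continuous b₂t
  u_x : ∀ x t, HasDerivAt (fun y => u (y, t)) (ux (x, t)) x
  θ_x : ∀ x t, HasDerivAt (fun y => θ (y, t)) (θx (x, t)) x
  w₁_x : ∀ x t, HasDerivAt (fun y => w₁ (y, t)) (w₁x (x, t)) x
  w₂_x : ∀ x t, HasDerivAt (fun y => w₂ (y, t)) (w₂x (x, t)) x
  b₁_x : ∀ x t, HasDerivAt (fun y => b₁ (y, t)) (b₁x (x, t)) x
  b₂_x : ∀ x t, HasDerivAt (fun y => b₂ (y, t)) (b₂x (x, t)) x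
  v_t : ∀ x, ∀ t ∈ Ioo 0 T, HasDerivAt (fun s => v (x, s)) (ux (x, t)) t
  u_t : ∀ x, ∀ t ∈ Ioo 0 T, HasDerivAt (fun s => u (x, s)) (ut (x, t)) t
  θ_t : ∀ x, ∀ t ∈ Ioo 0 T, HasDerivAt (fun s => θ (x, s)) (θt (x, t)) t
  w₁_t : ∀ x, ∀ t ∈ Ioo 0 T, HasDerivAt (fun s => w₁ (x, s)) (w₁t (x, t)) t
  w₂_t : ∀ x, ∀ t ∈ Ioo 0 T, HasDerivAt (fun s => w₂ (x, s)) (w₂t (x, t)) t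
  b₁_t : ∀ x, ∀ t ∈ Ioo 0 T, HasDerivAt (fun s => b₁ (x, s)) (b₁t (x, t)) t
  b₂_t : ∀ x, ∀ t ∈ Ioo 0 T, HasDerivAt (fun s => b₂ (x, s)) (b₂t (x, t)) t
  momentum : ∀ x t, HasDerivAt (fun y => visc α (v (y, t)) * ux (y, t) / v (y, t)
    - (θ (y, t) / v (y, t) + (b₁ (y, t) ^ 2 + b₂ (y, t) ^ 2) / 2)) (ut (x, t)) x
  transverse₁ : ∀ x t, HasDerivAt (fun y => w₁x (y, t) / v (y, t)) (w₁t (x, t) - b₁x (x, t)) x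
  transverse₂ : ∀ x t, HasDerivAt (fun y => w₂x (y, t) / v (y, t)) (w₂t (x, t) - b₂x (x, t)) x
  induction₁ : ∀ x t, HasDerivAt (fun y => b₁x (y, t) / v (y, t))
    (ux (x, t) * b₁ (x, t) + v (x, t) * b₁t (x, t) - w₁x (x, t)) x
  induction₂ : ∀ x t, HasDerivAt (fun y => b₂x (y, t) / v (y, t))
    (ux (x, t) * b₂ (x, t) + v (x, t) * b₂t (x, t) - w₂x (x, t)) x
  temperature : ∀ x t, HasDerivAt (fun y => θ (y, t) ^ β * θx (y, t) / v (y, t))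
    (θt (x, t) + θ (x, t) / v (x, t) * ux (x, t) - (visc α (v (x, t)) * ux (x, t) ^ 2
      + w₁x (x, t) ^ 2 + w₂x (x, t) ^ 2 + b₁x (x, t) ^ 2 + b₂x (x, t) ^ 2) / v (x, t)) x
  farfield : ∀ ε > 0, ∃ M : ℝ, ∀ x t, M ≤ |x| →
    |v (x, t) - 1| < ε ∧ |u (x, t)| < ε ∧ |θ (x, t) - 1| < ε ∧ |b₁ (x, t)| < ε ∧
    |b₂ (x, t)| < ε ∧ |w₁ (x, t)| < ε ∧ |w₂ (x, t)| < ε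

theorem one_le_visc {α z : ℝ} (hα : 0 ≤ α) (hz : 0 < z) : 1 ≤ visc α z := by
  have : 0 ≤ α * z ^ (-α) := by positivity
  unfold visc; linarith

namespace MHDFlow

variable {α β T : ℝ} (F : MHDFlow α β T)

/-- The viscosity along the flow. -/
def μ (p : ℝ × ℝ) : ℝ := visc α (F.v p)

/-- Total (thermal plus magnetic) pressure. -/
def pressure (p : ℝ × ℝ) : ℝ := F.θ p / F.v p + (F.b₁ p ^ 2 + F.b₂ p ^ 2) / 2

/-- Effective viscous stress. -/
def stress (p : ℝ × ℝ) : ℝ := F.μ p * F.ux p / F.v p - F.pressure p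

/-- Viscous and resistive heating. -/
def heating (p : ℝ × ℝ) : ℝ :=
  F.μ p * F.ux p ^ 2 + F.w₁x p ^ 2 + F.w₂x p ^ 2 + F.b₁x p ^ 2 + F.b₂x p ^ 2

/-- Relative entropy-energy density. -/
def energy (p : ℝ × ℝ) : ℝ :=
  F.u p ^ 2 / 2 + (F.v p - Real.log (F.v p) - 1) + (F.θ p - Real.log (F.θ p) - 1)
    + F.v p * (F.b₁ p ^ 2 + F.b₂ p ^ 2) / 2 + (F.w₁ p ^ 2 + F.w₂ p ^ 2) / 2

/-- Entropy dissipation density. -/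
def dissipation (p : ℝ × ℝ) : ℝ :=
  F.θ p ^ β * F.θx p ^ 2 / (F.v p * F.θ p ^ 2) + F.heating p / (F.v p * F.θ p)

/-- Time derivative of `energy`. -/
def energyRate (p : ℝ × ℝ) : ℝ :=
  F.u p * F.ut p + (1 - (F.v p)⁻¹) * F.ux p + (1 - (F.θ p)⁻¹) * F.θt p
    + (F.ux p * (F.b₁ p ^ 2 + F.b₂ p ^ 2) / 2
      + F.v p * (F.b₁ p * F.b₁t p + F.b₂ p * F.b₂t p))
    + (F.w₁ p * F.w₁t p + F.w₂ p * F.w₂t p)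

/-- Flux of `energy`. -/
def energyFlux (p : ℝ × ℝ) : ℝ :=
  F.u p * (F.stress p + 1) + (1 - (F.θ p)⁻¹) * (F.θ p ^ β * F.θx p / F.v p)
    + (F.b₁ p * (F.b₁x p / F.v p) + F.b₂ p * (F.b₂x p / F.v p))
    + (F.w₁ p * (F.w₁x p / F.v p) + F.w₂ p * (F.w₂x p / F.v p))
    + (F.w₁ p * F.b₁ p + F.w₂ p * F.b₂ p)

/-- The part of the flux that is not absorbed by the dissipation. -/
def remainder (p : ℝ × ℝ) : ℝ :=
  2 * (F.u p ^ 2 * F.μ p * F.θ p / F.v p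
    + (1 - (F.θ p)⁻¹) ^ 2 * F.θ p ^ β * F.θ p ^ 2 / F.v p
    + (F.b₁ p ^ 2 + F.b₂ p ^ 2 + F.w₁ p ^ 2 + F.w₂ p ^ 2) * F.θ p / F.v p)
  + |F.u p * (1 - F.pressure p) + (F.w₁ p * F.b₁ p + F.w₂ p * F.b₂ p)|

theorem continuous_μ : Continuous F.μ := by
  unfold μ visc
  exact continuous_const.add (continuous_const.mul
    (F.cont_v.rpow_const fun p => Or.inl (F.v_pos p).ne'))

theorem continuous_θ_rpow (r : ℝ) : Continuous fun p => F.θ p ^ r :=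
  F.cont_θ.rpow_const fun p => Or.inl (F.θ_pos p).ne'

theorem continuous_pressure : Continuous F.pressure := by
  unfold pressure
  have := F.cont_b₁; have := F.cont_b₂
  exact (F.cont_θ.div F.cont_v fun p => (F.v_pos p).ne').add (by fun_prop)

theorem continuous_stress : Continuous F.stress :=
  ((F.continuous_μ.mul F.cont_ux).div F.cont_v fun p => (F.v_pos p).ne').sub
    F.continuous_pressure

theorem continuous_heating : Continuous F.heating := by
  unfold heating
  have := F.continuous_μ; have := F.cont_ux; have := F.cont_w₁x; have := F.cont_w₂x
  have := F.cont_b₁x; have := F.cont_b₂x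
  fun_prop

theorem continuous_energy : Continuous F.energy := by
  unfold energy
  have := F.cont_u; have := F.cont_v; have := F.cont_θ; have := F.cont_w₁
  have := F.cont_w₂; have := F.cont_b₁; have := F.cont_b₂
  have := F.cont_v.log fun p => (F.v_pos p).ne'
  have := F.cont_θ.log fun p => (F.θ_pos p).ne'
  fun_prop

theorem continuous_dissipation : Continuous F.dissipation := by
  unfold dissipation
  have hv := F.v_pos; have hθ := F.θ_pos
  have := F.cont_v; have := F.cont_θ; have := F.continuous_θ_rpow β; have := F.cont_θx
  exact (Continuous.div (by fun_prop) (by fun_prop) fun p =>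
    mul_ne_zero (hv p).ne' (pow_ne_zero _ (hθ p).ne')).add
    (F.continuous_heating.div (by fun_prop) fun p => mul_ne_zero (hv p).ne' (hθ p).ne')

theorem continuous_inv_v : Continuous fun p => (F.v p)⁻¹ :=
  F.cont_v.inv₀ fun p => (F.v_pos p).ne'

theorem continuous_inv_θ : Continuous fun p => (F.θ p)⁻¹ :=
  F.cont_θ.inv₀ fun p => (F.θ_pos p).ne'

theorem continuous_energyRate : Continuous F.energyRate := by
  unfold energyRate
  have := F.cont_u; have := F.cont_v; have := F.cont_θ; have := F.cont_w₁
  have := F.cont_w₂; have := F.cont_b₁; have := F.cont_b₂; have := F.cont_ux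
  have := F.cont_ut; have := F.cont_θt; have := F.cont_w₁t
  have := F.cont_w₂t; have := F.cont_b₁t; have := F.cont_b₂t
  have := F.continuous_inv_v; have := F.continuous_inv_θ
  fun_prop

theorem continuous_energyFlux : Continuous F.energyFlux := by
  unfold energyFlux
  have := F.cont_u; have := F.cont_w₁; have := F.continuous_θ_rpow β
  have := F.cont_w₂; have := F.cont_b₁; have := F.cont_b₂; have := F.cont_θx
  have := F.cont_w₁x; have := F.cont_w₂x; have := F.cont_b₁x; have := F.cont_b₂x
  have := F.continuous_inv_v; have := F.continuous_inv_θ; have := F.continuous_stress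
  simp only [div_eq_mul_inv]
  fun_prop

theorem continuous_remainder : Continuous F.remainder := by
  unfold remainder
  have := F.cont_u; have := F.cont_w₁; have := F.continuous_θ_rpow β; have := F.cont_θ
  have := F.cont_w₂; have := F.cont_b₁; have := F.cont_b₂; have := F.continuous_μ
  have := F.continuous_inv_v; have := F.continuous_inv_θ; have := F.continuous_pressure
  simp only [div_eq_mul_inv]
  fun_prop

theorem μ_ge_one (hα : 0 ≤ α) (p) : 1 ≤ F.μ p := one_le_visc hα (F.v_pos p)

theorem heating_nonneg (hα : 0 ≤ α) (p) : 0 ≤ F.heating p := by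
  have := F.μ_ge_one hα p
  unfold heating; positivity

theorem dissipation_nonneg (hα : 0 ≤ α) (p) : 0 ≤ F.dissipation p := by
  have := F.heating_nonneg hα p
  have := F.v_pos p; have := F.θ_pos p
  unfold dissipation; positivity

theorem energy_nonneg (p) : 0 ≤ F.energy p := by
  have := F.v_pos p
  have h1 := Real.log_le_sub_one_of_pos (F.v_pos p)
  have h2 := Real.log_le_sub_one_of_pos (F.θ_pos p)
  have h3 : 0 ≤ F.v p * (F.b₁ p ^ 2 + F.b₂ p ^ 2) / 2 := by positivity
  unfold energy
  nlinarith [sq_nonneg (F.u p), sq_nonneg (F.w₁ p), sq_nonneg (F.w₂ p)]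

theorem hasDerivAt_energy (x : ℝ) {t : ℝ} (ht : t ∈ Ioo 0 T) :
    HasDerivAt (fun s => F.energy (x, s)) (F.energyRate (x, t)) t := by
  have hv := (F.v_pos (x, t)).ne'
  have hθ := (F.θ_pos (x, t)).ne'
  unfold energy
  refine ((((((F.u_t x t ht).pow 2).div_const 2).add
    (((F.v_t x t ht).sub ((F.v_t x t ht).log hv)).sub_const 1)).add
    (((F.θ_t x t ht).sub ((F.θ_t x t ht).log hθ)).sub_const 1)).add
    (((F.v_t x t ht).mul (((F.b₁_t x t ht).pow 2).add ((F.b₂_t x t ht).pow 2))).div_const 2)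
    |>.add ((((F.w₁_t x t ht).pow 2).add ((F.w₂_t x t ht).pow 2)).div_const 2)).congr_deriv ?_
  simp only [energyRate, Pi.add_apply, Pi.pow_apply]
  field_simp
  ring

theorem hasDerivAt_energyFlux (x t : ℝ) :
    HasDerivAt (fun y => F.energyFlux (y, t))
      (F.energyRate (x, t) - -F.dissipation (x, t)) x := by
  have hv := (F.v_pos (x, t)).ne'
  have hθ := (F.θ_pos (x, t)).ne'
  have hσ : HasDerivAt (fun y => F.stress (y, t)) (F.ut (x, t)) x := F.momentum x t
  have hi := ((F.θ_x x t).inv hθ).const_sub 1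
  unfold energyFlux
  refine ((((((F.u_x x t).mul (hσ.add_const 1)).add (hi.mul (F.temperature x t))).add
    (((F.b₁_x x t).mul (F.induction₁ x t)).add ((F.b₂_x x t).mul (F.induction₂ x t)))).add
    (((F.w₁_x x t).mul (F.transverse₁ x t)).add
      ((F.w₂_x x t).mul (F.transverse₂ x t)))).add
    (((F.w₁_x x t).mul (F.b₁_x x t)).add ((F.w₂_x x t).mul (F.b₂_x x t)))).congr_deriv ?_
  simp only [energyRate, dissipation, stress, pressure, heating, μ, Pi.inv_apply]
  field_simp
  ring

theorem flux_le (hα : 0 ≤ α) (p : ℝ × ℝ) {φ ψ c : ℝ} (h1 : ψ ^ 2 ≤ c) (h2 : |2 * φ * ψ| ≤ c) :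
    -(2 * φ * ψ * F.energyFlux p) ≤ φ ^ 2 * F.dissipation p / 2 + c * F.remainder p := by
  have hv := F.v_pos p
  have hθ := F.θ_pos p
  have hμ := F.μ_ge_one hα p
  have hΘ : 0 < F.θ p ^ β := Real.rpow_pos_of_pos hθ β
  set K := F.u p * (1 - F.pressure p) + (F.w₁ p * F.b₁ p + F.w₂ p * F.b₂ p) with hK
  set R := 2 * (F.u p ^ 2 * F.μ p * F.θ p / F.v p
    + (1 - (F.θ p)⁻¹) ^ 2 * F.θ p ^ β * F.θ p ^ 2 / F.v p
    + (F.b₁ p ^ 2 + F.b₂ p ^ 2 + F.w₁ p ^ 2 + F.w₂ p ^ 2) * F.θ p / F.v p) with hR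
  have hR0 : 0 ≤ R := by positivity
  have e : φ ^ 2 * F.dissipation p / 2 + 2 * φ * ψ * F.energyFlux p + ψ ^ 2 * R
      - 2 * φ * ψ * K
      = F.μ p / (2 * F.v p * F.θ p) * (φ * F.ux p + 2 * ψ * F.u p * F.θ p) ^ 2
      + F.θ p ^ β / (2 * F.v p * F.θ p ^ 2)
        * (φ * F.θx p + 2 * ψ * (1 - (F.θ p)⁻¹) * F.θ p ^ 2) ^ 2
      + 1 / (2 * F.v p * F.θ p) * ((φ * F.b₁x p + 2 * ψ * F.b₁ p * F.θ p) ^ 2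
        + (φ * F.b₂x p + 2 * ψ * F.b₂ p * F.θ p) ^ 2
        + (φ * F.w₁x p + 2 * ψ * F.w₁ p * F.θ p) ^ 2
        + (φ * F.w₂x p + 2 * ψ * F.w₂ p * F.θ p) ^ 2) := by
    simp only [hK, hR, dissipation, energyFlux, heating, stress, pressure]
    field_simp
    ring
  have e0 : 0 ≤ φ ^ 2 * F.dissipation p / 2 + 2 * φ * ψ * F.energyFlux p + ψ ^ 2 * R
      - 2 * φ * ψ * K := by
    rw [e]; positivity
  have h3 : -(2 * φ * ψ * K) ≤ c * |K| := by
    calc -(2 * φ * ψ * K) ≤ |2 * φ * ψ * K| := neg_le_abs _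
      _ = |2 * φ * ψ| * |K| := abs_mul _ _
      _ ≤ c * |K| := by gcongr
  have h4 : ψ ^ 2 * R ≤ c * R := by gcongr
  have h5 : F.remainder p = R + |K| := rfl
  rw [h5]
  linarith [mul_add c R |K|]

end MHDFlow

namespace MHDFlow

variable {α β T : ℝ} (F : MHDFlow α β T)

theorem tendsto_remainder :
    Tendsto F.remainder (comap (fun p : ℝ × ℝ => |p.1|) atTop) (nhds 0) := by
  have key : ∀ {f : ℝ × ℝ → ℝ} {c : ℝ},
      (∀ ε > 0, ∃ M : ℝ, ∀ x t, M ≤ |x| → |f (x, t) - c| < ε) →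
      Tendsto f (comap (fun p : ℝ × ℝ => |p.1|) atTop) (nhds c) := by
    intro f c h
    rw [Metric.tendsto_nhds]
    intro ε hε
    obtain ⟨M, hM⟩ := h ε hε
    exact mem_comap.2 ⟨Ici M, Ici_mem_atTop M, fun p hp => by
      rw [mem_ofPred_eq, Real.dist_eq]; exact hM p.1 p.2 hp⟩
  have hv := key (f := F.v) (c := 1) fun ε hε => (F.farfield ε hε).imp fun M h x t hx =>
    (h x t hx).1
  have hu := key (f := F.u) (c := 0) fun ε hε => (F.farfield ε hε).imp fun M h x t hx => by
    simpa using (h x t hx).2.1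
  have hθ := key (f := F.θ) (c := 1) fun ε hε => (F.farfield ε hε).imp fun M h x t hx =>
    (h x t hx).2.2.1
  have hb₁ := key (f := F.b₁) (c := 0) fun ε hε => (F.farfield ε hε).imp fun M h x t hx => by
    simpa using (h x t hx).2.2.2.1
  have hb₂ := key (f := F.b₂) (c := 0) fun ε hε => (F.farfield ε hε).imp fun M h x t hx => by
    simpa using (h x t hx).2.2.2.2.1
  have hw₁ := key (f := F.w₁) (c := 0) fun ε hε => (F.farfield ε hε).imp fun M h x t hx => by
    simpa using (h x t hx).2.2.2.2.2.1
  have hw₂ := key (f := F.w₂) (c := 0) fun ε hε => (F.farfield ε hε).imp fun M h x t hx => by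
    simpa using (h x t hx).2.2.2.2.2.2
  have hμ := ((hv.rpow_const (p := -α) (Or.inl one_ne_zero)).const_mul α).const_add 1
  have hΘ := hθ.rpow_const (p := β) (Or.inl one_ne_zero)
  have hp := (hθ.div hv one_ne_zero).add (((hb₁.pow 2).add (hb₂.pow 2)).div_const 2)
  have h := ((((((hu.pow 2).mul hμ).mul hθ).div hv one_ne_zero).add
    (((((hθ.inv₀ one_ne_zero).const_sub 1).pow 2).mul hΘ |>.mul (hθ.pow 2)).div hv
      one_ne_zero)).add
    ((((((hb₁.pow 2).add (hb₂.pow 2)).add (hw₁.pow 2)).add (hw₂.pow 2)).mul hθ).div hv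
      one_ne_zero)).const_mul 2 |>.add
    ((hu.mul (hp.const_sub 1)).add ((hw₁.mul hb₁).add (hw₂.mul hb₂))).abs
  have hc : (2 : ℝ) * (0 ^ 2 * (1 + α * 1 ^ (-α)) * 1 / 1 + (1 - 1⁻¹) ^ 2 * 1 ^ β * 1 ^ 2 / 1
      + (0 ^ 2 + 0 ^ 2 + 0 ^ 2 + 0 ^ 2) * 1 / 1)
      + |0 * (1 - (1 / 1 + (0 ^ 2 + 0 ^ 2) / 2)) + (0 * 0 + 0 * 0)| = 0 := by norm_num
  rw [hc] at h
  exact h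

/-- The remainder is small at infinity, in an integrated form. -/
theorem exists_remainder_le {ε : ℝ} (hε : 0 < ε) :
    ∃ B : ℝ, 0 ≤ B ∧ ∀ x, ∀ t ∈ Icc 0 T, F.remainder (x, t) ≤ ε + B * (1 + x ^ 2)⁻¹ := by
  have h1 := F.tendsto_remainder.eventually (gt_mem_nhds hε)
  obtain ⟨s, hs, hsub⟩ := mem_comap.1 h1
  obtain ⟨M, hM⟩ := mem_atTop_sets.1 hs
  obtain ⟨B, hB⟩ := ((isCompact_Icc (a := -M) (b := M)).prod
    (isCompact_Icc (a := (0:ℝ)) (b := T))).exists_bound_of_continuousOn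
    F.continuous_remainder.continuousOn
  refine ⟨|B| * (1 + M ^ 2), by positivity, fun x t ht => ?_⟩
  rcases le_total M |x| with hx | hx
  · have : F.remainder (x, t) < ε := hsub (hM |x| hx)
    have h2 : 0 ≤ |B| * (1 + M ^ 2) * (1 + x ^ 2)⁻¹ := by positivity
    linarith
  · have h2 := hB (x, t) ⟨abs_le.1 hx, ht⟩
    have h3 : F.remainder (x, t) ≤ |B| := (le_abs_self _).trans (h2.trans (le_abs_self _))
    have h4 : |B| ≤ |B| * (1 + M ^ 2) * (1 + x ^ 2)⁻¹ := by
      rw [mul_assoc]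
      apply le_mul_of_one_le_right (abs_nonneg B)
      rw [← div_eq_mul_inv, one_le_div (by positivity)]
      have : x ^ 2 ≤ M ^ 2 := sq_le_sq' (abs_le.1 hx).1 (abs_le.1 hx).2
      linarith
    linarith

theorem weighted_energy_le (hα : 0 ≤ α) {L : ℝ} (hL : 1 ≤ L) {t : ℝ} (ht : t ∈ Icc 0 T) :
    (∫ x in -L..L, (1 - x ^ 2 / L ^ 2) ^ 2 * F.energy (x, t))
      + ∫ s in (0 : ℝ)..t, ∫ x in -L..L, (1 - x ^ 2 / L ^ 2) ^ 2 * F.dissipation (x, s) / 2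
    ≤ (∫ x in -L..L, F.energy (x, 0))
      + ∫ s in (0 : ℝ)..t, ∫ x in -L..L, 4 / L * F.remainder (x, s) := by
  have hL0 : 0 < L := by linarith
  have hLL : -L ≤ L := by linarith
  have hη := F.continuous_energy
  have hD := F.continuous_dissipation
  have hJ := F.continuous_energyFlux
  have hR := F.continuous_remainder
  set φ : ℝ → ℝ := fun x => 1 - x ^ 2 / L ^ 2 with hφ
  set ψ : ℝ → ℝ := fun x => -(2 * x / L ^ 2) with hψ
  have hφd : ∀ x, HasDerivAt φ (ψ x) x := fun x => by
    have := (((hasDerivAt_id x).pow 2).div_const (L ^ 2)).const_sub 1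
    refine this.congr_deriv ?_
    simp [hψ]
  have hφ2 : ∀ x, HasDerivAt (fun x => φ x ^ 2) (2 * φ x * ψ x) x := fun x => by
    refine ((hφd x).pow 2).congr_deriv ?_
    simp
  have hφc : Continuous φ := by fun_prop
  have hψc : Continuous ψ := by fun_prop
  have hφ01 : ∀ x ∈ Icc (-L) L, 0 ≤ φ x ∧ φ x ≤ 1 := fun x hx => by
    have h1 : x ^ 2 ≤ L ^ 2 := sq_le_sq' hx.1 hx.2
    have h2 : x ^ 2 / L ^ 2 ≤ 1 := by rw [div_le_one (by positivity)]; exact h1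
    have h3 : 0 ≤ x ^ 2 / L ^ 2 := by positivity
    simp only [hφ]
    constructor <;> linarith
  have hψb : ∀ x ∈ Icc (-L) L, |ψ x| ≤ 2 / L := fun x hx => by
    simp only [hψ, abs_neg, abs_div, abs_mul, abs_pow]
    rw [abs_of_pos hL0, abs_two, div_le_div_iff₀ (by positivity) hL0]
    have : |x| ≤ L := abs_le.2 hx
    nlinarith
  have hw := balance_law_weak_form (S := fun p => -F.dissipation p) hη F.continuous_energyRate
    hJ hD.neg hφ2 (by fun_prop) (fun x s hs => F.hasDerivAt_energy x hs)
    (fun x s => F.hasDerivAt_energyFlux x s) (-L) L ht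
  have hφL : φ L = 0 := by simp [hφ, hL0.ne']
  have hφL' : φ (-L) = 0 := by simp [hφ, hL0.ne']
  simp only [hφL, hφL', ne_eq, OfNat.ofNat_ne_zero, not_false_eq_true, zero_pow, zero_mul,
    sub_self, zero_add] at hw
  have h1 : ∫ s in (0 : ℝ)..t, ∫ x in -L..L,
        (φ x ^ 2 * -F.dissipation (x, s) - 2 * φ x * ψ x * F.energyFlux (x, s))
      ≤ ∫ s in (0 : ℝ)..t, ∫ x in -L..L,
        (4 / L * F.remainder (x, s) - φ x ^ 2 * F.dissipation (x, s) / 2) := by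
    apply intervalIntegral.integral_mono_on ht.1
    · exact Continuous.intervalIntegrable (by fun_prop) _ _
    · exact Continuous.intervalIntegrable (by fun_prop) _ _
    intro s _
    apply intervalIntegral.integral_mono_on hLL
    · exact Continuous.intervalIntegrable (by fun_prop) _ _
    · exact Continuous.intervalIntegrable (by fun_prop) _ _
    intro x hx
    have hψx := hψb x hx
    obtain ⟨h0, h1⟩ := hφ01 x hx
    have e4 : (2 / L) ^ 2 ≤ 4 / L := by
      rw [div_pow, div_le_div_iff₀ (by positivity) hL0]; nlinarith
    have := F.flux_le hα (x, s) (φ := φ x) (ψ := ψ x) (c := 4 / L)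
      (by
        rw [← sq_abs]
        exact (pow_le_pow_left₀ (abs_nonneg _) hψx 2).trans e4)
      (by
        rw [abs_mul, abs_mul, abs_two, abs_of_nonneg h0]
        calc 2 * φ x * |ψ x| ≤ 2 * 1 * (2 / L) := by gcongr
          _ = 4 / L := by ring)
    linarith
  have h2 : ∫ s in (0 : ℝ)..t, ∫ x in -L..L,
        (4 / L * F.remainder (x, s) - φ x ^ 2 * F.dissipation (x, s) / 2)
      = (∫ s in (0 : ℝ)..t, ∫ x in -L..L, 4 / L * F.remainder (x, s))
        - ∫ s in (0 : ℝ)..t, ∫ x in -L..L, φ x ^ 2 * F.dissipation (x, s) / 2 := by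
    rw [← intervalIntegral.integral_sub]
    · congr 1; ext s
      rw [← intervalIntegral.integral_sub] <;>
        exact Continuous.intervalIntegrable (by fun_prop) _ _
    all_goals exact Continuous.intervalIntegrable (by fun_prop) _ _
  have h3 : ∫ x in -L..L, φ x ^ 2 * F.energy (x, 0) ≤ ∫ x in -L..L, F.energy (x, 0) := by
    apply intervalIntegral.integral_mono_on hLL
    · exact Continuous.intervalIntegrable (by fun_prop) _ _
    · exact Continuous.intervalIntegrable (by fun_prop) _ _
    intro x hx
    obtain ⟨h0, h1⟩ := hφ01 x hx
    exact mul_le_of_le_one_left (F.energy_nonneg _) (pow_le_one₀ h0 h1)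
  linarith

/-- Global entropy-energy inequality. -/
theorem energy_le (hα : 0 ≤ α) {E : ℝ} (hE : ∀ L, 1 ≤ L → ∫ x in -L..L, F.energy (x, 0) ≤ E)
    {a b : ℝ} (hab : a ≤ b) {t : ℝ} (ht : t ∈ Icc 0 T) :
    (∫ x in a..b, F.energy (x, t))
      + ∫ s in (0 : ℝ)..t, ∫ x in a..b, F.dissipation (x, s) / 2 ≤ E := by
  have hη := F.continuous_energy
  have hD := F.continuous_dissipation
  have hR := F.continuous_remainder
  set X := (∫ x in a..b, F.energy (x, t))
      + ∫ s in (0 : ℝ)..t, ∫ x in a..b, F.dissipation (x, s) / 2 with hX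
  set N := max |a| |b| with hN
  have hN0 : 0 ≤ N := (abs_nonneg a).trans (le_max_left _ _)
  have hTt : 0 ≤ T := ht.1.trans ht.2
  have haN : -N ≤ a := by
    have := neg_abs_le a; have := le_max_left |a| |b|; linarith
  have hbN : b ≤ N := (le_abs_self b).trans (le_max_right _ _)
  have main : ∀ ε > 0, X ≤ E + 8 * T * ε := by
    intro ε hε
    obtain ⟨B, hB0, hB⟩ := F.exists_remainder_le hε
    have step : ∀ L, max 1 N ≤ L → (1 - N ^ 2 / L ^ 2) ^ 2 * X
        ≤ E + 8 * T * ε + 4 * T * B * Real.pi / L := by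
      intro L hLN
      have hL : 1 ≤ L := (le_max_left _ _).trans hLN
      have hNL : N ≤ L := (le_max_right _ _).trans hLN
      have hL0 : 0 < L := by linarith
      have hw := F.weighted_energy_le hα hL ht
      have sub : ∀ f : ℝ → ℝ, Continuous f → (∀ x, 0 ≤ f x) →
          (1 - N ^ 2 / L ^ 2) ^ 2 * ∫ x in a..b, f x
            ≤ ∫ x in -L..L, (1 - x ^ 2 / L ^ 2) ^ 2 * f x := by
        intro f hf hf0
        calc (1 - N ^ 2 / L ^ 2) ^ 2 * ∫ x in a..b, f x
            = ∫ x in a..b, (1 - N ^ 2 / L ^ 2) ^ 2 * f x := by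
              rw [intervalIntegral.integral_const_mul]
          _ ≤ ∫ x in a..b, (1 - x ^ 2 / L ^ 2) ^ 2 * f x := by
              apply intervalIntegral.integral_mono_on hab
              · exact Continuous.intervalIntegrable (by fun_prop) _ _
              · exact Continuous.intervalIntegrable (by fun_prop) _ _
              intro x hx
              have h1 : x ^ 2 ≤ N ^ 2 := sq_le_sq' (haN.trans hx.1) (hx.2.trans hbN)
              have h2 : x ^ 2 / L ^ 2 ≤ N ^ 2 / L ^ 2 := by gcongr
              have h3 : N ^ 2 / L ^ 2 ≤ 1 := by
                rw [div_le_one (by positivity)]; gcongr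
              have := hf0 x
              gcongr
          _ ≤ ∫ x in -L..L, (1 - x ^ 2 / L ^ 2) ^ 2 * f x := by
              apply intervalIntegral.integral_mono_interval (by linarith) hab (by linarith)
              · exact Eventually.of_forall fun x => mul_nonneg (sq_nonneg _) (hf0 x)
              · exact Continuous.intervalIntegrable (by fun_prop) _ _
      have h1 := sub (fun x => F.energy (x, t)) (by fun_prop) fun x => F.energy_nonneg _
      have h2 : (1 - N ^ 2 / L ^ 2) ^ 2
            * ∫ s in (0 : ℝ)..t, ∫ x in a..b, F.dissipation (x, s) / 2
          ≤ ∫ s in (0 : ℝ)..t, ∫ x in -L..L,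
            (1 - x ^ 2 / L ^ 2) ^ 2 * F.dissipation (x, s) / 2 := by
        rw [← intervalIntegral.integral_const_mul]
        apply intervalIntegral.integral_mono_on ht.1
        · exact Continuous.intervalIntegrable (by fun_prop) _ _
        · exact Continuous.intervalIntegrable (by fun_prop) _ _
        intro s _
        have := sub (fun x => F.dissipation (x, s) / 2) (by fun_prop)
          fun x => div_nonneg (F.dissipation_nonneg hα _) zero_le_two
        simpa only [mul_div_assoc] using this
      have h3 : ∫ s in (0 : ℝ)..t, ∫ x in -L..L, 4 / L * F.remainder (x, s)
          ≤ 8 * T * ε + 4 * T * B * Real.pi / L := by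
        have inner : ∀ s ∈ Icc 0 t, ∫ x in -L..L, 4 / L * F.remainder (x, s)
            ≤ 8 * ε + 4 * B * Real.pi / L := by
          intro s hs
          have hc : Continuous fun x : ℝ => (1 + x ^ 2)⁻¹ :=
            Continuous.inv₀ (by fun_prop) fun x => by positivity
          calc ∫ x in -L..L, 4 / L * F.remainder (x, s)
              ≤ ∫ x in -L..L, (4 / L * ε + 4 / L * B * (1 + x ^ 2)⁻¹) := by
                apply intervalIntegral.integral_mono_on (by linarith)
                · exact Continuous.intervalIntegrable (by fun_prop) _ _
                · exact Continuous.intervalIntegrable (by fun_prop) _ _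
                intro x _
                have := hB x s ⟨hs.1, hs.2.trans ht.2⟩
                calc 4 / L * F.remainder (x, s) ≤ 4 / L * (ε + B * (1 + x ^ 2)⁻¹) := by gcongr
                  _ = _ := by ring
            _ = (2 * L) * (4 / L * ε) + 4 / L * B * (Real.arctan L - Real.arctan (-L)) := by
                rw [intervalIntegral.integral_add, intervalIntegral.integral_const,
                  intervalIntegral.integral_const_mul, integral_inv_one_add_sq]
                · simp only [smul_eq_mul]; ring
                all_goals exact Continuous.intervalIntegrable (by fun_prop) _ _
            _ ≤ 8 * ε + 4 * B * Real.pi / L := by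
                have h5 := Real.arctan_lt_pi_div_two L
                have h6 := Real.neg_pi_div_two_lt_arctan (-L)
                have h7 : (2 * L) * (4 / L * ε) = 8 * ε := by field_simp; norm_num
                have h8 : 4 / L * B * (Real.arctan L - Real.arctan (-L))
                    ≤ 4 / L * B * Real.pi := by gcongr; linarith
                have h9 : 4 / L * B * Real.pi = 4 * B * Real.pi / L := by ring
                linarith
        calc ∫ s in (0 : ℝ)..t, ∫ x in -L..L, 4 / L * F.remainder (x, s)
            ≤ ∫ s in (0 : ℝ)..t, (8 * ε + 4 * B * Real.pi / L) := by
              apply intervalIntegral.integral_mono_on ht.1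
              · exact Continuous.intervalIntegrable (by fun_prop) _ _
              · exact Continuous.intervalIntegrable (by fun_prop) _ _
              exact inner
          _ = t * (8 * ε + 4 * B * Real.pi / L) := by
              rw [intervalIntegral.integral_const]; simp
          _ ≤ T * (8 * ε + 4 * B * Real.pi / L) := by
              have := ht.2; have := Real.pi_pos; gcongr
          _ = _ := by ring
      have := hE L hL
      rw [hX, mul_add]
      linarith
    have hlim : Tendsto (fun L : ℝ => (1 - N ^ 2 / L ^ 2) ^ 2 * X) atTop
        (nhds ((1 - 0) ^ 2 * X)) :=
      (((tendsto_const_nhds.div_atTop (tendsto_pow_atTop two_ne_zero)).const_sub 1).pow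
        2).mul_const X
    have hlim' : Tendsto (fun L : ℝ => E + 8 * T * ε + 4 * T * B * Real.pi / L) atTop
        (nhds (E + 8 * T * ε + 0)) :=
      (tendsto_const_nhds.div_atTop tendsto_id).const_add _
    have := le_of_tendsto_of_tendsto hlim hlim'
      ((eventually_ge_atTop (max 1 N)).mono step)
    linarith
  refine le_of_forall_pos_le_add fun δ hδ => ?_
  have := main (δ / (8 * (T + 1))) (by positivity)
  refine this.trans ?_
  have : 8 * T * (δ / (8 * (T + 1))) ≤ δ := by
    rw [mul_div_assoc', div_le_iff₀ (by positivity)]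
    nlinarith
  linarith

end MHDFlow

theorem le_two_mul_sub_log {z : ℝ} (hz : 0 < z) : z ≤ 2 * (z - Real.log z - 1) + 2 := by
  have h1 := Real.log_le_sub_one_of_pos (half_pos hz)
  rw [Real.log_div hz.ne' two_ne_zero] at h1
  have := Real.log_two_lt_d9
  linarith

theorem mul_log_add_le_exp {α A z : ℝ} (hα : 0 ≤ α) (hz : 0 < z) :
    Real.exp (-A - Real.exp (α * A)) * (Real.log z + A)
      ≤ Real.exp (Real.log z - z ^ (-α)) := by
  rcases le_or_gt (Real.log z + A) 0 with h | h
  · exact (mul_nonpos_of_nonneg_of_nonpos (Real.exp_pos _).le h).trans (Real.exp_pos _).le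
  · have h1 : z ^ (-α) ≤ Real.exp (α * A) := by
      rw [Real.rpow_def_of_pos hz]
      apply Real.exp_le_exp.2
      nlinarith
    calc Real.exp (-A - Real.exp (α * A)) * (Real.log z + A)
        ≤ Real.exp (-A - Real.exp (α * A)) * Real.exp (Real.log z + A) := by
          gcongr
          have := Real.add_one_le_exp (Real.log z + A)
          linarith
      _ = Real.exp (Real.log z - Real.exp (α * A)) := by rw [← Real.exp_add]; congr 1; ring
      _ ≤ _ := by gcongr

namespace MHDFlow

variable {α β T : ℝ} (F : MHDFlow α β T)

/-- Primitive of `μ(v) / v`. -/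
def potential (p : ℝ × ℝ) : ℝ := Real.log (F.v p) - F.v p ^ (-α)

theorem continuous_potential : Continuous F.potential :=
  (F.cont_v.log fun p => (F.v_pos p).ne').sub
    (F.cont_v.rpow_const fun p => Or.inl (F.v_pos p).ne')

theorem potential_le_log (p) : F.potential p ≤ Real.log (F.v p) := by
  have := Real.rpow_pos_of_pos (F.v_pos p) (-α)
  unfold potential; linarith

theorem hasDerivAt_potential (x : ℝ) {t : ℝ} (ht : t ∈ Ioo 0 T) :
    HasDerivAt (fun s => F.potential (x, s)) (F.stress (x, t) + F.pressure (x, t)) t := by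
  have hv := F.v_pos (x, t)
  refine (((F.v_t x t ht).log hv.ne').sub
    ((F.v_t x t ht).rpow_const (p := -α) (Or.inl hv.ne'))).congr_deriv ?_
  simp only [stress, μ, visc]
  rw [Real.rpow_sub_one hv.ne']
  field_simp
  ring

theorem potential_eq (x : ℝ) {t : ℝ} (ht : t ∈ Icc 0 T) :
    F.potential (x, t) = F.potential (x, 0) + (∫ s in (0 : ℝ)..t, F.stress (x, s))
      + ∫ s in (0 : ℝ)..t, F.pressure (x, s) := by
  have h1 := F.continuous_stress
  have h2 := F.continuous_pressure
  have := sub_eq_integral_time (ηt := fun p => F.stress p + F.pressure p)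
    F.continuous_potential (by fun_prop) (fun x s hs => F.hasDerivAt_potential x hs) x ht
  rw [intervalIntegral.integral_add] at this
  · linarith
  all_goals exact Continuous.intervalIntegrable (by fun_prop) _ _

theorem integral_stress_sub (x y : ℝ) {t : ℝ} (ht : t ∈ Icc 0 T) :
    (∫ s in (0 : ℝ)..t, F.stress (y, s)) - ∫ s in (0 : ℝ)..t, F.stress (x, s)
      = (∫ z in x..y, F.u (z, t)) - ∫ z in x..y, F.u (z, 0) := by
  have h1 := F.continuous_stress
  have := balance_law_weak_form (S := fun _ => 0) (χ := fun _ => 1) (χ' := fun _ => 0)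
    F.cont_u F.cont_ut h1 continuous_const
    (fun x => hasDerivAt_const x 1) continuous_const (fun x s hs => F.u_t x s hs)
    (fun x s => (F.momentum x s).congr_deriv (by simp)) x y ht
  simp only [one_mul, mul_zero, zero_mul, sub_zero, intervalIntegral.integral_zero,
    add_zero] at this
  rw [this, intervalIntegral.integral_sub] <;>
    exact Continuous.intervalIntegrable (by fun_prop) _ _

theorem pressure_nonneg (p) : 0 ≤ F.pressure p := by
  have := F.v_pos p; have := F.θ_pos p
  unfold pressure; positivity

section Local

variable {A : ℝ}

theorem integral_le_of_le_energy {f : ℝ → ℝ} (hf : Continuous f) {m t : ℝ}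
    (hA : ∫ x in (m - 1)..(m + 1), F.energy (x, t) ≤ A / 2 - 2)
    (h : ∀ x, f x ≤ 2 * F.energy (x, t) + 2) : ∫ x in (m - 1)..(m + 1), f x ≤ A := by
  have hη := F.continuous_energy
  calc ∫ x in (m - 1)..(m + 1), f x
      ≤ ∫ x in (m - 1)..(m + 1), (2 * F.energy (x, t) + 2) := by
        apply intervalIntegral.integral_mono_on (by linarith)
        · exact Continuous.intervalIntegrable (by fun_prop) _ _
        · exact Continuous.intervalIntegrable (by fun_prop) _ _
        exact fun x _ => h x
    _ = 2 * (∫ x in (m - 1)..(m + 1), F.energy (x, t)) + 4 := by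
        rw [intervalIntegral.integral_add, intervalIntegral.integral_const_mul,
          intervalIntegral.integral_const]
        · simp only [smul_eq_mul]; ring
        all_goals exact Continuous.intervalIntegrable (by fun_prop) _ _
    _ ≤ A := by linarith

theorem energy_parts (p) : 0 ≤ F.u p ^ 2 ∧ 0 ≤ F.v p - Real.log (F.v p) - 1 ∧
    0 ≤ F.θ p - Real.log (F.θ p) - 1 ∧ 0 ≤ F.v p * (F.b₁ p ^ 2 + F.b₂ p ^ 2) ∧
    0 ≤ F.w₁ p ^ 2 + F.w₂ p ^ 2 := by
  have hv := F.v_pos p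
  have h1 := Real.log_le_sub_one_of_pos (F.v_pos p)
  have h2 := Real.log_le_sub_one_of_pos (F.θ_pos p)
  refine ⟨by positivity, by linarith, by linarith, by positivity, by positivity⟩

theorem integral_v_le {m t : ℝ}
    (hA : ∫ x in (m - 1)..(m + 1), F.energy (x, t) ≤ A / 2 - 2) :
    ∫ x in (m - 1)..(m + 1), F.v (x, t) ≤ A := by
  have := F.cont_v
  refine F.integral_le_of_le_energy (by fun_prop) hA fun x => ?_
  obtain ⟨h1, h2, h3, h4, h5⟩ := F.energy_parts (x, t)
  have := le_two_mul_sub_log (F.v_pos (x, t))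
  unfold energy; linarith

theorem integral_θ_le {m t : ℝ}
    (hA : ∫ x in (m - 1)..(m + 1), F.energy (x, t) ≤ A / 2 - 2) :
    ∫ x in (m - 1)..(m + 1), F.θ (x, t) ≤ A := by
  have := F.cont_θ
  refine F.integral_le_of_le_energy (by fun_prop) hA fun x => ?_
  obtain ⟨h1, h2, h3, h4, h5⟩ := F.energy_parts (x, t)
  have := le_two_mul_sub_log (F.θ_pos (x, t))
  unfold energy; linarith

theorem integral_abs_u_le {m t : ℝ}
    (hA : ∫ x in (m - 1)..(m + 1), F.energy (x, t) ≤ A / 2 - 2) :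
    ∫ x in (m - 1)..(m + 1), |F.u (x, t)| ≤ A := by
  have := F.cont_u
  refine F.integral_le_of_le_energy (by fun_prop) hA fun x => ?_
  obtain ⟨h1, h2, h3, h4, h5⟩ := F.energy_parts (x, t)
  have : |F.u (x, t)| ≤ F.u (x, t) ^ 2 + 2 := by
    rw [← sq_abs]; nlinarith [sq_nonneg (|F.u (x, t)| - 1)]
  unfold energy; linarith

theorem integral_magnetic_le {m t : ℝ}
    (hA : ∫ x in (m - 1)..(m + 1), F.energy (x, t) ≤ A / 2 - 2) :
    ∫ x in (m - 1)..(m + 1), F.v (x, t) * (F.b₁ (x, t) ^ 2 + F.b₂ (x, t) ^ 2) ≤ A := by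
  have := F.cont_v; have := F.cont_b₁; have := F.cont_b₂
  refine F.integral_le_of_le_energy (by fun_prop) hA fun x => ?_
  obtain ⟨h1, h2, h3, h4, h5⟩ := F.energy_parts (x, t)
  unfold energy; linarith

theorem neg_le_integral_log_v {m t : ℝ}
    (hA : ∫ x in (m - 1)..(m + 1), F.energy (x, t) ≤ A / 2 - 2) :
    -A ≤ ∫ x in (m - 1)..(m + 1), Real.log (F.v (x, t)) := by
  have := F.cont_v.log fun p => (F.v_pos p).ne'
  have h := F.integral_le_of_le_energy (f := fun x => -Real.log (F.v (x, t)))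
    (this.comp (by fun_prop : Continuous fun x : ℝ => (x, t))).neg hA fun x => by
      obtain ⟨h1, h2, h3, h4, h5⟩ := F.energy_parts (x, t)
      have := F.v_pos (x, t)
      unfold energy; linarith
  rw [intervalIntegral.integral_neg] at h
  linarith

theorem abs_integral_stress_sub_le {m : ℝ}
    (hA : ∀ t ∈ Icc 0 T, ∫ x in (m - 1)..(m + 1), F.energy (x, t) ≤ A / 2 - 2)
    {x t : ℝ} (hx : x ∈ Icc (m - 1) (m + 1)) (ht : t ∈ Icc 0 T) :
    |(∫ s in (0 : ℝ)..t, F.stress (x, s)) - ∫ s in (0 : ℝ)..t, F.stress (m, s)|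
      ≤ 2 * A := by
  have hu := F.cont_u
  have key : ∀ t ∈ Icc 0 T, abs (∫ z in m..x, F.u (z, t)) ≤ A := by
    intro t ht
    have hi : IntervalIntegrable (fun z => |F.u (z, t)|) volume (m - 1) (m + 1) :=
      Continuous.intervalIntegrable (by fun_prop) _ _
    calc abs (∫ z in m..x, F.u (z, t)) ≤ abs (∫ z in m..x, abs (F.u (z, t))) :=
          by simpa only [Real.norm_eq_abs] using
            intervalIntegral.norm_integral_le_abs_integral_norm
              (f := fun z => F.u (z, t)) (a := m) (b := x) (μ := volume)
      _ ≤ abs (∫ z in (m - 1)..(m + 1), abs (F.u (z, t))) := by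
          apply intervalIntegral.abs_integral_mono_interval
          · rw [uIoc_of_le (by linarith : m - 1 ≤ m + 1)]
            intro y hy
            rcases mem_uIoc.1 hy with h | h
            · exact ⟨by linarith [h.1], by linarith [h.2, hx.2]⟩
            · exact ⟨by linarith [h.1, hx.1], by linarith [h.2]⟩
          · exact Eventually.of_forall fun z => abs_nonneg _
          · exact hi
      _ = ∫ z in (m - 1)..(m + 1), abs (F.u (z, t)) :=
          abs_of_nonneg (intervalIntegral.integral_nonneg (by linarith) fun _ _ => abs_nonneg _)
      _ ≤ A := F.integral_abs_u_le (hA t ht)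
  rw [F.integral_stress_sub m x ht]
  have h1 := key t ht
  have h2 := key 0 ⟨le_rfl, ht.1.trans ht.2⟩
  calc _ ≤ abs (∫ z in m..x, F.u (z, t)) + abs (∫ z in m..x, F.u (z, 0)) := abs_sub _ _
    _ ≤ _ := by linarith

end Local

end MHDFlow

namespace MHDFlow

variable {α β T : ℝ} (F : MHDFlow α β T)

/-- Accumulated effective stress. -/
def impulse (p : ℝ × ℝ) : ℝ := ∫ s in (0 : ℝ)..p.2, F.stress (p.1, s)

/-- Accumulated pressure. -/
def load (p : ℝ × ℝ) : ℝ := ∫ s in (0 : ℝ)..p.2, F.pressure (p.1, s)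

theorem continuous_impulse : Continuous F.impulse := by
  have := F.continuous_stress
  exact intervalIntegral.continuous_parametric_intervalIntegral_of_continuous
    (f := fun (p : ℝ × ℝ) s => F.stress (p.1, s)) (by fun_prop) continuous_snd

theorem continuous_load : Continuous F.load := by
  have := F.continuous_pressure
  exact intervalIntegral.continuous_parametric_intervalIntegral_of_continuous
    (f := fun (p : ℝ × ℝ) s => F.pressure (p.1, s)) (by fun_prop) continuous_snd

theorem exp_load_eq (x t : ℝ) :
    Real.exp (F.load (x, t))
      = 1 + ∫ s in (0 : ℝ)..t, F.pressure (x, s) * Real.exp (F.load (x, s)) := by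
  have hp := F.continuous_pressure
  have hl := F.continuous_load
  have hd : ∀ s, HasDerivAt (fun s => Real.exp (F.load (x, s)))
      (F.pressure (x, s) * Real.exp (F.load (x, s))) s := by
    intro s
    have hc : Continuous fun s => F.pressure (x, s) := by fun_prop
    have := (intervalIntegral.integral_hasDerivAt_right (hc.intervalIntegrable 0 s)
      (hc.stronglyMeasurableAtFilter _ _) hc.continuousAt).exp
    exact this.congr_deriv (mul_comm _ _)
  rw [intervalIntegral.integral_eq_sub_of_hasDerivAt (fun s _ => hd s)
    (Continuous.intervalIntegrable (by fun_prop) _ _)]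
  simp [load]

theorem load_eq (x : ℝ) {t : ℝ} (ht : t ∈ Icc 0 T) :
    F.load (x, t) = F.potential (x, t) - F.potential (x, 0) - F.impulse (x, t) := by
  have := F.potential_eq x ht
  simp only [load, impulse]
  linarith

section Local

variable {A V c₀ m : ℝ}

theorem four_le_of_energy_le {t : ℝ}
    (hA : ∫ x in (m - 1)..(m + 1), F.energy (x, t) ≤ A / 2 - 2) : 4 ≤ A := by
  have := intervalIntegral.integral_nonneg (μ := volume) (by linarith : m - 1 ≤ m + 1)
    fun x _ => F.energy_nonneg (x, t)
  linarith

theorem impulse_bounds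
    (hA : ∀ t ∈ Icc 0 T, ∫ x in (m - 1)..(m + 1), F.energy (x, t) ≤ A / 2 - 2)
    {x t : ℝ} (hx : x ∈ Icc (m - 1) (m + 1)) (ht : t ∈ Icc 0 T) :
    F.impulse (m, t) - 2 * A ≤ F.impulse (x, t) ∧
      F.impulse (x, t) ≤ F.impulse (m, t) + 2 * A := by
  have := abs_le.1 (F.abs_integral_stress_sub_le hA hx ht)
  simp only [impulse]
  constructor <;> linarith

theorem le_integral_exp_load (hα : 0 ≤ α)
    (hA : ∀ t ∈ Icc 0 T, ∫ x in (m - 1)..(m + 1), F.energy (x, t) ≤ A / 2 - 2)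
    (hV : ∀ x, F.potential (x, 0) ≤ V) {t : ℝ} (ht : t ∈ Icc 0 T) :
    Real.exp (-A - Real.exp (α * A)) * Real.exp (-V - 2 * A) * Real.exp (-F.impulse (m, t))
      ≤ ∫ x in (m - 1)..(m + 1), Real.exp (F.load (x, t)) := by
  have hl := F.continuous_load
  have hlog : Continuous fun x => Real.log (F.v (x, t)) :=
    (F.cont_v.log fun p => (F.v_pos p).ne').comp (by fun_prop : Continuous fun x : ℝ => (x, t))
  set a := Real.exp (-A - Real.exp (α * A)) with ha
  set b := Real.exp (-V - 2 * A) * Real.exp (-F.impulse (m, t)) with hb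
  have ha0 : 0 < a := Real.exp_pos _
  have hb0 : 0 < b := by positivity
  have h4 := F.four_le_of_energy_le (hA t ht)
  have h1 := F.neg_le_integral_log_v (hA t ht)
  calc a * Real.exp (-V - 2 * A) * Real.exp (-F.impulse (m, t)) = a * b * 1 := by rw [hb]; ring
    _ ≤ a * b * ((∫ x in (m - 1)..(m + 1), Real.log (F.v (x, t))) + 2 * A) := by
        gcongr; linarith
    _ = ∫ x in (m - 1)..(m + 1), a * b * (Real.log (F.v (x, t)) + A) := by
        rw [intervalIntegral.integral_const_mul, intervalIntegral.integral_add,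
          intervalIntegral.integral_const]
        · simp only [smul_eq_mul]; ring
        all_goals exact Continuous.intervalIntegrable (by fun_prop) _ _
    _ ≤ _ := by
        apply intervalIntegral.integral_mono_on (by linarith)
        · exact Continuous.intervalIntegrable (by fun_prop) _ _
        · exact Continuous.intervalIntegrable (by fun_prop) _ _
        intro x hx
        have h2 := mul_log_add_le_exp (A := A) hα (F.v_pos (x, t))
        have h3 := F.impulse_bounds hA hx ht
        have h5 := hV x
        calc a * b * (Real.log (F.v (x, t)) + A)
            = b * (a * (Real.log (F.v (x, t)) + A)) := by ring
          _ ≤ b * Real.exp (F.potential (x, t)) := by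
              gcongr; exact h2
          _ ≤ _ := by
              rw [hb, ← Real.exp_add, ← Real.exp_add, F.load_eq x ht]
              apply Real.exp_le_exp.2
              linarith

theorem integral_exp_load_le
    (hA : ∀ t ∈ Icc 0 T, ∫ x in (m - 1)..(m + 1), F.energy (x, t) ≤ A / 2 - 2)
    (h₀ : ∀ x, c₀ ≤ F.potential (x, 0)) {t : ℝ} (ht : t ∈ Icc 0 T) :
    ∫ x in (m - 1)..(m + 1), Real.exp (F.load (x, t))
      ≤ 2 + 2 * A * Real.exp (2 * A - c₀)
        * ∫ s in (0 : ℝ)..t, Real.exp (-F.impulse (m, s)) := by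
  have hl := F.continuous_load
  have hp := F.continuous_pressure
  have hi := F.continuous_impulse
  have hθ := F.cont_θ
  have hv := F.cont_v
  have hb₁ := F.cont_b₁
  have hb₂ := F.cont_b₂
  have hc : Continuous fun x => ∫ s in (0 : ℝ)..t, F.pressure (x, s) * Real.exp (F.load (x, s)) :=
    intervalIntegral.continuous_parametric_intervalIntegral_of_continuous'
      (f := fun x s => F.pressure (x, s) * Real.exp (F.load (x, s))) (by fun_prop) 0 t
  rw [intervalIntegral.integral_congr fun x _ => F.exp_load_eq x t,
    intervalIntegral.integral_add (by simp) (hc.intervalIntegrable _ _),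
    intervalIntegral.integral_const,
    integral_swap_of_continuous (f := fun p => F.pressure p * Real.exp (F.load p))
      (by fun_prop), ← intervalIntegral.integral_const_mul]
  have h1 : (m + 1 - (m - 1)) • (1 : ℝ) = 2 := by simp only [smul_eq_mul]; ring
  rw [h1]
  gcongr
  have hc' : Continuous fun s => ∫ x in (m - 1)..(m + 1),
      F.pressure (x, s) * Real.exp (F.load (x, s)) :=
    intervalIntegral.continuous_parametric_intervalIntegral_of_continuous'
      (f := fun s x => F.pressure (x, s) * Real.exp (F.load (x, s))) (by fun_prop) _ _
  apply intervalIntegral.integral_mono_on ht.1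
  · exact hc'.intervalIntegrable _ _
  · exact Continuous.intervalIntegrable (by fun_prop) _ _
  intro s hs
  have hs' : s ∈ Icc 0 T := ⟨hs.1, hs.2.trans ht.2⟩
  set k := Real.exp (2 * A - c₀) * Real.exp (-F.impulse (m, s)) with hk
  have hk0 : 0 < k := by positivity
  calc ∫ x in (m - 1)..(m + 1), F.pressure (x, s) * Real.exp (F.load (x, s))
      ≤ ∫ x in (m - 1)..(m + 1), k * (F.θ (x, s)
          + F.v (x, s) * (F.b₁ (x, s) ^ 2 + F.b₂ (x, s) ^ 2)) := by
        apply intervalIntegral.integral_mono_on (by linarith)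
        · exact Continuous.intervalIntegrable (by fun_prop) _ _
        · exact Continuous.intervalIntegrable (by fun_prop) _ _
        intro x hx
        have hvp := F.v_pos (x, s)
        have h3 := F.impulse_bounds hA hx hs'
        have h5 := h₀ x
        have h6 := F.potential_le_log (x, s)
        have h7 : Real.exp (F.load (x, s)) ≤ k * F.v (x, s) := by
          calc Real.exp (F.load (x, s))
              ≤ Real.exp (2 * A - c₀ + -F.impulse (m, s) + Real.log (F.v (x, s))) := by
                rw [F.load_eq x hs']
                apply Real.exp_le_exp.2
                linarith
            _ = k * F.v (x, s) := by rw [Real.exp_add, Real.exp_log hvp, Real.exp_add, hk]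
        calc F.pressure (x, s) * Real.exp (F.load (x, s))
            ≤ F.pressure (x, s) * (k * F.v (x, s)) := by
              have := F.pressure_nonneg (x, s)
              gcongr
          _ = k * (F.θ (x, s)
              + F.v (x, s) * (F.b₁ (x, s) ^ 2 + F.b₂ (x, s) ^ 2) / 2) := by
              unfold pressure; field_simp
          _ ≤ _ := by
              have : 0 ≤ F.v (x, s) * (F.b₁ (x, s) ^ 2 + F.b₂ (x, s) ^ 2) := by positivity
              gcongr
              linarith
    _ = k * ((∫ x in (m - 1)..(m + 1), F.θ (x, s)) + ∫ x in (m - 1)..(m + 1),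
          F.v (x, s) * (F.b₁ (x, s) ^ 2 + F.b₂ (x, s) ^ 2)) := by
        rw [intervalIntegral.integral_const_mul, intervalIntegral.integral_add]
        all_goals exact Continuous.intervalIntegrable (by fun_prop) _ _
    _ ≤ k * (A + A) := by
        have := F.integral_θ_le (hA s hs')
        have := F.integral_magnetic_le (hA s hs')
        gcongr
    _ = _ := by rw [hk]; ring

/-- Bound for `exp (-impulse)` in terms of the data. -/
def impulseBound (α T A V c₀ : ℝ) : ℝ :=
  2 / (Real.exp (-A - Real.exp (α * A)) * Real.exp (-V - 2 * A))
    * Real.exp (2 * A * Real.exp (2 * A - c₀)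
      / (Real.exp (-A - Real.exp (α * A)) * Real.exp (-V - 2 * A)) * T)

theorem impulseBound_pos (α T A V c₀ : ℝ) : 0 < impulseBound α T A V c₀ := by
  unfold impulseBound; positivity

theorem exp_neg_impulse_le (hα : 0 ≤ α)
    (hA : ∀ t ∈ Icc 0 T, ∫ x in (m - 1)..(m + 1), F.energy (x, t) ≤ A / 2 - 2)
    (hV : ∀ x, F.potential (x, 0) ≤ V) (h₀ : ∀ x, c₀ ≤ F.potential (x, 0))
    {t : ℝ} (ht : t ∈ Icc 0 T) :
    Real.exp (-F.impulse (m, t)) ≤ impulseBound α T A V c₀ := by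
  have hi := F.continuous_impulse
  have h4 := F.four_le_of_energy_le (hA t ht)
  unfold impulseBound
  set a := Real.exp (-A - Real.exp (α * A)) * Real.exp (-V - 2 * A) with ha
  have ha0 : 0 < a := by positivity
  have key := le_mul_exp_of_le_add_integral (Y := fun s => Real.exp (-F.impulse (m, s)))
    (A := 2 / a) (B := 2 * A * Real.exp (2 * A - c₀) / a) (T := T) (by fun_prop) (by positivity)
    (fun s hs => by
      have h1 := (F.le_integral_exp_load hα hA hV hs).trans (F.integral_exp_load_le hA h₀ hs)
      rw [div_mul_eq_mul_div, ← add_div, le_div_iff₀ ha0, mul_comm]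
      exact h1) t ht
  refine key.trans ?_
  gcongr
  exact ht.2

theorem exp_div_impulseBound_le (hα : 0 ≤ α)
    (hA : ∀ t ∈ Icc 0 T, ∫ x in (m - 1)..(m + 1), F.energy (x, t) ≤ A / 2 - 2)
    (hV : ∀ x, F.potential (x, 0) ≤ V) (h₀ : ∀ x, c₀ ≤ F.potential (x, 0))
    {t : ℝ} (ht : t ∈ Icc 0 T) :
    Real.exp c₀ / impulseBound α T A V c₀ ≤ F.v (m, t) := by
  have h1 := F.exp_neg_impulse_le hα hA hV h₀ ht
  have h2 := F.potential_eq m ht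
  have h3 := F.potential_le_log (m, t)
  have h5 : 0 ≤ ∫ s in (0 : ℝ)..t, F.pressure (m, s) :=
    intervalIntegral.integral_nonneg ht.1 fun s _ => F.pressure_nonneg _
  have h6 := h₀ m
  have hv := F.v_pos (m, t)
  rw [div_le_iff₀ (impulseBound_pos _ _ _ _ _)]
  calc Real.exp c₀ = Real.exp (c₀ + F.impulse (m, t)) * Real.exp (-F.impulse (m, t)) := by
        rw [← Real.exp_add]; congr 1; ring
    _ ≤ F.v (m, t) * _ := by
        gcongr
        rw [← Real.le_log_iff_exp_le hv]
        unfold impulse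
        linarith

end Local

end MHDFlow

theorem abs_sub_le_integral_abs_deriv {f f' : ℝ → ℝ} (hd : ∀ x, HasDerivAt f (f' x) x)
    (hf' : Continuous f') {a b x y : ℝ} (hx : x ∈ Icc a b) (hy : y ∈ Icc a b) :
    |f x - f y| ≤ ∫ z in a..b, |f' z| := by
  have hab : a ≤ b := hx.1.trans hx.2
  rw [← intervalIntegral.integral_eq_sub_of_hasDerivAt (fun z _ => hd z)
    (hf'.intervalIntegrable _ _)]
  calc abs (∫ z in y..x, f' z) ≤ abs (∫ z in y..x, abs (f' z)) := by
        simpa only [Real.norm_eq_abs] using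
          intervalIntegral.norm_integral_le_abs_integral_norm
            (f := f') (a := y) (b := x) (μ := volume)
    _ ≤ abs (∫ z in a..b, abs (f' z)) := by
        apply intervalIntegral.abs_integral_mono_interval
        · rw [uIoc_of_le hab]
          intro w hw
          rcases mem_uIoc.1 hw with h | h
          · exact ⟨by linarith [h.1, hy.1], by linarith [h.2, hx.2]⟩
          · exact ⟨by linarith [h.1, hx.1], by linarith [h.2, hy.2]⟩
        · exact Eventually.of_forall fun z => abs_nonneg _
        · exact hf'.abs.intervalIntegrable _ _
    _ = ∫ z in a..b, abs (f' z) :=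
        abs_of_nonneg (intervalIntegral.integral_nonneg hab fun _ _ => abs_nonneg _)

theorem sq_sub_le_weighted {f f' w : ℝ → ℝ} (hd : ∀ x, HasDerivAt f (f' x) x)
    (hf' : Continuous f') (hw : Continuous w) (hw₀ : ∀ x, 0 < w x) {a b x y : ℝ}
    (hx : x ∈ Icc a b) (hy : y ∈ Icc a b) :
    (f x - f y) ^ 2 ≤ (∫ z in a..b, w z) * ∫ z in a..b, f' z ^ 2 / w z := by
  have hs : ∀ x, 0 < √(w x) := fun x => Real.sqrt_pos.2 (hw₀ x)
  have h1 := sq_integral_mul_le (f := fun z => √(w z)) (g := fun z => |f' z| / √(w z))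
    hw.sqrt (hf'.abs.div hw.sqrt fun z => (hs z).ne') (hx.1.trans hx.2)
  simp only [mul_div_cancel₀ _ (hs _).ne', div_pow, sq_abs, Real.sq_sqrt (hw₀ _).le] at h1
  refine le_trans ?_ h1
  rw [← sq_abs]
  gcongr
  exact abs_sub_le_integral_abs_deriv hd hf' hx hy

/-- Parabolic cutoff vanishing at `m - 1` and `m + 1`. -/
def bump (m x : ℝ) : ℝ := 1 - (x - m) ^ 2

theorem hasDerivAt_bump (m x : ℝ) : HasDerivAt (bump m) (-2 * (x - m)) x := by
  have := (((hasDerivAt_id x).sub_const m).pow 2).const_sub 1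
  refine this.congr_deriv ?_
  simp

theorem continuous_bump (m : ℝ) : Continuous (bump m) := by unfold bump; fun_prop

theorem bump_sq_mem {m x : ℝ} (hx : x ∈ Icc (m - 1) (m + 1)) :
    0 ≤ bump m x ^ 2 ∧ bump m x ^ 2 ≤ 1 := by
  have h1 : 0 ≤ bump m x := by unfold bump; nlinarith [hx.1, hx.2]
  have h2 : bump m x ≤ 1 := by unfold bump; nlinarith
  exact ⟨by positivity, by nlinarith⟩

theorem deriv_bump_sq_le {m x : ℝ} (hx : x ∈ Icc (m - 1) (m + 1)) :
    (-2 * (x - m)) ^ 2 ≤ 4 := by nlinarith [hx.1, hx.2]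

theorem bump_self (m : ℝ) : bump m m = 1 := by simp [bump]

theorem bump_left (m : ℝ) : bump m (m - 1) = 0 := by simp [bump]

theorem bump_right (m : ℝ) : bump m (m + 1) = 0 := by simp [bump]

namespace MHDFlow

variable {α β T : ℝ} (F : MHDFlow α β T) {A m : ℝ}

theorem exists_θ_le {t : ℝ}
    (hA : ∫ x in (m - 1)..(m + 1), F.energy (x, t) ≤ A / 2 - 2) :
    ∃ y ∈ Icc (m - 1) (m + 1), F.θ (y, t) ≤ A := by
  have hθ := F.cont_θ
  by_contra! h
  have h4 := F.four_le_of_energy_le hA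
  have h1 := F.integral_θ_le hA
  have h2 : ∫ x in (m - 1)..(m + 1), A ≤ ∫ x in (m - 1)..(m + 1), F.θ (x, t) :=
    intervalIntegral.integral_mono_on (by linarith) (by simp)
      (Continuous.intervalIntegrable (by fun_prop) _ _) fun x hx => (h x hx).le
  rw [intervalIntegral.integral_const, smul_eq_mul] at h2
  linarith

theorem θ_le_of_one_le (hα : 0 ≤ α) (hβ : 1 ≤ β) {x t : ℝ} (hx : x ∈ Icc (m - 1) (m + 1))
    (hA : ∫ x in (m - 1)..(m + 1), F.energy (x, t) ≤ A / 2 - 2) :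
    F.θ (x, t) ≤ 1 + 2 * A ^ β
      + β ^ 2 / 2 * A * ∫ z in (m - 1)..(m + 1), F.dissipation (z, t) := by
  obtain ⟨y, hy, hyA⟩ := F.exists_θ_le hA
  have hvc := F.cont_v
  have hθx := F.cont_θx
  have hDc := F.continuous_dissipation
  have hc : Continuous fun z => F.θx (z, t) * (β / 2) * F.θ (z, t) ^ (β / 2 - 1) :=
    (by fun_prop : Continuous fun z => F.θx (z, t) * (β / 2)).mul
      ((F.continuous_θ_rpow (β / 2 - 1)).comp (by fun_prop : Continuous fun z : ℝ => (z, t)))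
  have h4 := F.four_le_of_energy_le hA
  have hpow : ∀ z, (F.θ (z, t) ^ (β / 2)) ^ 2 = F.θ (z, t) ^ β := fun z => by
    rw [← Real.rpow_natCast, ← Real.rpow_mul (F.θ_pos _).le]
    norm_num
  have h1 := sq_sub_le_weighted (f := fun z => F.θ (z, t) ^ (β / 2))
    (f' := fun z => F.θx (z, t) * (β / 2) * F.θ (z, t) ^ (β / 2 - 1))
    (w := fun z => F.v (z, t))
    (fun z => (F.θ_x z t).rpow_const (Or.inl (F.θ_pos _).ne')) hc (by fun_prop)
    (fun z => F.v_pos _) hx hy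
  have h2 : (∫ z in (m - 1)..(m + 1),
      (F.θx (z, t) * (β / 2) * F.θ (z, t) ^ (β / 2 - 1)) ^ 2 / F.v (z, t))
      ≤ β ^ 2 / 4 * ∫ z in (m - 1)..(m + 1), F.dissipation (z, t) := by
    rw [← intervalIntegral.integral_const_mul]
    apply intervalIntegral.integral_mono_on (by linarith)
    · exact ((hc.pow 2).div (by fun_prop) fun z => (F.v_pos _).ne').intervalIntegrable _ _
    · exact Continuous.intervalIntegrable (by fun_prop) _ _
    intro z _
    have hv := F.v_pos (z, t)
    have hθ := F.θ_pos (z, t)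
    have hH := F.heating_nonneg hα (z, t)
    have h3 : 0 ≤ F.heating (z, t) / (F.v (z, t) * F.θ (z, t)) := by positivity
    calc (F.θx (z, t) * (β / 2) * F.θ (z, t) ^ (β / 2 - 1)) ^ 2 / F.v (z, t)
        = β ^ 2 / 4 * (F.θ (z, t) ^ β * F.θx (z, t) ^ 2 / (F.v (z, t) * F.θ (z, t) ^ 2)) := by
          rw [Real.rpow_sub_one hθ.ne', ← hpow]
          field_simp
          ring
      _ ≤ β ^ 2 / 4 * F.dissipation (z, t) := by
          unfold dissipation
          gcongr
          linarith
  have h5 := F.integral_v_le hA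
  have h6 : 0 ≤ ∫ z in (m - 1)..(m + 1), F.dissipation (z, t) :=
    intervalIntegral.integral_nonneg (by linarith) fun z _ => F.dissipation_nonneg hα _
  have h7 : (F.θ (x, t) ^ (β / 2) - F.θ (y, t) ^ (β / 2)) ^ 2
      ≤ A * (β ^ 2 / 4 * ∫ z in (m - 1)..(m + 1), F.dissipation (z, t)) :=
    h1.trans (mul_le_mul h5 h2 (intervalIntegral.integral_nonneg (by linarith) fun z _ =>
      div_nonneg (sq_nonneg _) (F.v_pos _).le) (by linarith))
  have h8 : F.θ (y, t) ^ β ≤ A ^ β := Real.rpow_le_rpow (F.θ_pos _).le hyA (by linarith)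
  have h9 : F.θ (x, t) ≤ 1 + F.θ (x, t) ^ β := by
    have hp := Real.rpow_pos_of_pos (F.θ_pos (x, t)) β
    rcases le_total (F.θ (x, t)) 1 with h | h
    · linarith
    · have := Real.rpow_le_rpow_of_exponent_le h hβ
      rw [Real.rpow_one] at this
      linarith
  have h10 := hpow x
  have h11 := hpow y
  nlinarith [sq_nonneg (F.θ (x, t) ^ (β / 2) - 2 * F.θ (y, t) ^ (β / 2))]

end MHDFlow

theorem exists_rpow_le_mul_add {β ε : ℝ} (hβ : 0 < β) (hβ1 : β < 1) (hε : 0 < ε) :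
    ∃ C, 0 ≤ C ∧ ∀ z : ℝ, 0 < z → z ^ (1 - β) ≤ ε * z + C := by
  set R := ε ^ (-β⁻¹) with hR
  have hR0 : 0 < R := Real.rpow_pos_of_pos hε _
  refine ⟨R ^ (1 - β), (Real.rpow_pos_of_pos hR0 _).le, fun z hz => ?_⟩
  rcases le_total z R with h | h
  · have := Real.rpow_le_rpow hz.le h (by linarith : 0 ≤ 1 - β)
    have : 0 ≤ ε * z := by positivity
    linarith
  · have h1 : z ^ (-β) ≤ R ^ (-β) := Real.rpow_le_rpow_of_nonpos hR0 h (by linarith)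
    have h2 : R ^ (-β) = ε := by
      rw [hR, ← Real.rpow_mul hε.le]
      rw [show -β⁻¹ * -β = 1 by field_simp, Real.rpow_one]
    have h3 : z ^ (1 - β) = z ^ (-β) * z := by
      rw [← Real.rpow_add_one hz.ne']; congr 1; ring
    have h4 : 0 < R ^ (1 - β) := Real.rpow_pos_of_pos hR0 _
    rw [h3, ← h2]
    have := mul_le_mul_of_nonneg_right h1 hz.le
    linarith

namespace MHDFlow

variable {α β T : ℝ} (F : MHDFlow α β T) {A m : ℝ}

/-- Source term in the balance law for `θ ^ (1 - β) / (1 - β)`. -/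
def powerSource (p : ℝ × ℝ) : ℝ :=
  F.θ p ^ (-β) * ((F.heating p - F.θ p * F.ux p) / F.v p)
    + β * (F.θx p ^ 2 / (F.θ p * F.v p))

/-- Localized logarithmic temperature gradient. -/
def conduction (m t : ℝ) : ℝ :=
  ∫ x in (m - 1)..(m + 1), bump m x ^ 2 * (F.θx (x, t) ^ 2 / (F.θ (x, t) * F.v (x, t)))

/-- `powerSource` tested against `bump m ^ 2`, with the flux integrated by parts. -/
def localSource (m : ℝ) (p : ℝ × ℝ) : ℝ :=
  bump m p.1 ^ 2 * F.powerSource p - 2 * bump m p.1 * (-2 * (p.1 - m)) * (F.θx p / F.v p)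

theorem continuous_logGradient : Continuous fun p => F.θx p ^ 2 / (F.θ p * F.v p) :=
  (F.cont_θx.pow 2).div (F.cont_θ.mul F.cont_v) fun p => (mul_pos (F.θ_pos p) (F.v_pos p)).ne'

theorem continuous_powerSource : Continuous F.powerSource := by
  have h1 := F.continuous_heating
  have h2 := F.cont_θ
  have h3 := F.cont_ux
  exact ((F.continuous_θ_rpow (-β)).mul (((by fun_prop : Continuous fun p =>
    F.heating p - F.θ p * F.ux p)).div F.cont_v fun p => (F.v_pos p).ne')).add
    (continuous_const.mul F.continuous_logGradient)

theorem continuous_conduction : Continuous (F.conduction m) := by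
  have h1 := F.continuous_logGradient
  have h2 := continuous_bump m
  have h3 : Continuous fun p : ℝ × ℝ =>
      bump m p.2 ^ 2 * (F.θx (p.2, p.1) ^ 2 / (F.θ (p.2, p.1) * F.v (p.2, p.1))) :=
    ((h2.comp continuous_snd).pow 2).mul (h1.comp (by fun_prop : Continuous fun p : ℝ × ℝ =>
      (p.2, p.1)))
  exact intervalIntegral.continuous_parametric_intervalIntegral_of_continuous' h3 _ _

theorem hasDerivAt_logFlux (x t : ℝ) :
    HasDerivAt (fun y => F.θx (y, t) / F.v (y, t))
      (F.θ (x, t) ^ (-β) * F.θt (x, t) - F.powerSource (x, t)) x := by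
  have hθ := F.θ_pos (x, t)
  have hv := F.v_pos (x, t)
  have e : (fun y => F.θx (y, t) / F.v (y, t))
      = fun y => F.θ (y, t) ^ (-β) * (F.θ (y, t) ^ β * F.θx (y, t) / F.v (y, t)) := by
    ext y
    have hθ := F.θ_pos (y, t)
    have := Real.rpow_pos_of_pos hθ β
    rw [Real.rpow_neg hθ.le]
    field_simp
  rw [e]
  refine (((F.θ_x x t).rpow_const (p := -β) (Or.inl hθ.ne')).mul
    (F.temperature x t)).congr_deriv ?_
  have := Real.rpow_pos_of_pos hθ β
  simp only [powerSource, heating, μ]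
  rw [Real.rpow_sub_one hθ.ne', Real.rpow_neg hθ.le]
  field_simp
  ring

theorem hasDerivAt_power (hβ1 : β < 1) (x : ℝ) {t : ℝ} (ht : t ∈ Ioo 0 T) :
    HasDerivAt (fun s => F.θ (x, s) ^ (1 - β) / (1 - β))
      (F.θ (x, t) ^ (-β) * F.θt (x, t)) t := by
  refine (((F.θ_t x t ht).rpow_const (Or.inl (F.θ_pos _).ne')).div_const _).congr_deriv ?_
  have : 1 - β ≠ 0 := by linarith
  rw [show 1 - β - 1 = -β by ring]
  field_simp

theorem power_balance (hβ1 : β < 1) {t : ℝ} (ht : t ∈ Icc 0 T) :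
    (∫ x in (m - 1)..(m + 1), bump m x ^ 2 * (F.θ (x, t) ^ (1 - β) / (1 - β)))
      - ∫ x in (m - 1)..(m + 1), bump m x ^ 2 * (F.θ (x, 0) ^ (1 - β) / (1 - β))
      = ∫ s in (0 : ℝ)..t, ∫ x in (m - 1)..(m + 1), F.localSource m (x, s) := by
  have hb := continuous_bump m
  have := balance_law_weak_form (η := fun p => F.θ p ^ (1 - β) / (1 - β))
    (ηt := fun p => F.θ p ^ (-β) * F.θt p) (J := fun p => F.θx p / F.v p)
    (S := F.powerSource) (χ := fun x => bump m x ^ 2)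
    (χ' := fun x => 2 * bump m x * (-2 * (x - m)))
    ((F.continuous_θ_rpow _).div_const _) ((F.continuous_θ_rpow _).mul F.cont_θt)
    (F.cont_θx.div F.cont_v fun p => (F.v_pos p).ne') F.continuous_powerSource
    (fun x => ((hasDerivAt_bump m x).pow 2).congr_deriv (by simp)) (by fun_prop)
    (fun x s hs => F.hasDerivAt_power hβ1 x hs) (fun x s => F.hasDerivAt_logFlux x s)
    (m - 1) (m + 1) ht
  simpa [bump_left, bump_right, localSource] using this

theorem le_powerSource (hα : 0 ≤ α) (hβ : 0 < β) (p : ℝ × ℝ) {c ε C M φ ψ : ℝ} (hc : 0 < c)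
    (hcv : c ≤ F.v p) (hε : 0 ≤ ε) (hC : 0 ≤ C)
    (hεC : F.θ p ^ (1 - β) ≤ ε * F.θ p + C) (hφ : φ ^ 2 ≤ 1) (hψ : ψ ^ 2 ≤ 4)
    (hM : φ ^ 2 * F.θ p ≤ M) :
    β / 2 * (φ ^ 2 * (F.θx p ^ 2 / (F.θ p * F.v p)))
        - (8 / (β * c) + (ε * M + C) / (4 * c)) * F.θ p
      ≤ φ ^ 2 * F.powerSource p - 2 * φ * ψ * (F.θx p / F.v p) := by
  have hv := F.v_pos p
  have hθ := F.θ_pos p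
  have hr := Real.rpow_pos_of_pos hθ (-β)
  have hμ := F.μ_ge_one hα p
  have h1 : F.θ p ^ (1 - β) = F.θ p ^ (-β) * F.θ p := by
    rw [← Real.rpow_add_one hθ.ne']; congr 1; ring
  have hM0 : 0 ≤ M := le_trans (by positivity) hM
  have h2 : 0 ≤ F.heating p - F.θ p * F.ux p + F.θ p ^ 2 / 4 := by
    have : F.ux p ^ 2 ≤ F.μ p * F.ux p ^ 2 := le_mul_of_one_le_left (sq_nonneg _) hμ
    unfold heating
    nlinarith [sq_nonneg (F.ux p - F.θ p / 2), sq_nonneg (F.w₁x p), sq_nonneg (F.w₂x p),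
      sq_nonneg (F.b₁x p), sq_nonneg (F.b₂x p)]
  have h3 : 0 ≤ φ ^ 2 * (F.θ p ^ (-β) * ((F.heating p - F.θ p * F.ux p) / F.v p))
      + φ ^ 2 * F.θ p ^ (1 - β) * (F.θ p / (4 * F.v p)) := by
    have e : φ ^ 2 * (F.θ p ^ (-β) * ((F.heating p - F.θ p * F.ux p) / F.v p))
      + φ ^ 2 * F.θ p ^ (1 - β) * (F.θ p / (4 * F.v p))
      = φ ^ 2 * F.θ p ^ (-β) * ((F.heating p - F.θ p * F.ux p + F.θ p ^ 2 / 4) / F.v p) := by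
      rw [h1]; field_simp
    rw [e]; positivity
  have h4 : φ ^ 2 * F.θ p ^ (1 - β) ≤ ε * M + C := by
    calc φ ^ 2 * F.θ p ^ (1 - β) ≤ φ ^ 2 * (ε * F.θ p + C) := by gcongr
      _ = ε * (φ ^ 2 * F.θ p) + φ ^ 2 * C := by ring
      _ ≤ ε * M + 1 * C := by gcongr
      _ = _ := by ring
  have h5 : φ ^ 2 * F.θ p ^ (1 - β) * (F.θ p / (4 * F.v p))
      ≤ (ε * M + C) / (4 * c) * F.θ p := by
    calc _ ≤ (ε * M + C) * (F.θ p / (4 * c)) := by gcongr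
      _ = _ := by ring
  have h6 : 0 ≤ β / 2 * (φ ^ 2 * (F.θx p ^ 2 / (F.θ p * F.v p)))
      - 2 * φ * ψ * (F.θx p / F.v p) + 2 / β * (F.θ p / F.v p) * ψ ^ 2 := by
    have e : β / 2 * (φ ^ 2 * (F.θx p ^ 2 / (F.θ p * F.v p)))
      - 2 * φ * ψ * (F.θx p / F.v p) + 2 / β * (F.θ p / F.v p) * ψ ^ 2
      = β / (2 * F.θ p * F.v p) * (φ * F.θx p - 2 / β * ψ * F.θ p) ^ 2 := by
      field_simp; ring
    rw [e]; positivity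
  have h7 : 2 / β * (F.θ p / F.v p) * ψ ^ 2 ≤ 8 / (β * c) * F.θ p := by
    calc _ ≤ 2 / β * (F.θ p / c) * 4 := by gcongr
      _ = _ := by field_simp; ring
  have e : φ ^ 2 * F.powerSource p = φ ^ 2 * (F.θ p ^ (-β) *
      ((F.heating p - F.θ p * F.ux p) / F.v p))
      + β * (φ ^ 2 * (F.θx p ^ 2 / (F.θ p * F.v p))) := by
    unfold powerSource; ring
  rw [e, add_mul]
  linarith

theorem bump_sq_mul_θ_le {c t : ℝ} (hc : 0 < c)
    (hA : ∫ x in (m - 1)..(m + 1), F.energy (x, t) ≤ A / 2 - 2)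
    (hcv : ∀ x, c ≤ F.v (x, t)) {x : ℝ} (hx : x ∈ Icc (m - 1) (m + 1)) :
    bump m x ^ 2 * F.θ (x, t) ≤ 8 * A ^ 2 / c + A / 2 * F.conduction m t := by
  have hb := continuous_bump m
  have hθc := F.cont_θ
  have hθx := F.cont_θx
  have hvc := F.cont_v
  have h4 := F.four_le_of_energy_le hA
  have hs : ∀ z, 0 < √(F.θ (z, t)) := fun z => Real.sqrt_pos.2 (F.θ_pos _)
  have hq : ∀ z, √(F.θ (z, t)) ^ 2 = F.θ (z, t) := fun z => Real.sq_sqrt (F.θ_pos _).le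
  have hc' : Continuous fun z => -2 * (z - m) * √(F.θ (z, t))
      + bump m z * (F.θx (z, t) / (2 * √(F.θ (z, t)))) :=
    (by fun_prop : Continuous fun z => -2 * (z - m) * √(F.θ (z, t))).add
      (hb.mul ((by fun_prop : Continuous fun z => F.θx (z, t)).div (by fun_prop)
        fun z => (mul_pos two_pos (hs z)).ne'))
  have hG : Continuous fun z => bump m z ^ 2 * (F.θx (z, t) ^ 2 / (F.θ (z, t) * F.v (z, t))) :=
    (hb.pow 2).mul (F.continuous_logGradient.comp (by fun_prop : Continuous fun z : ℝ => (z, t)))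
  have h1 := sq_sub_le_weighted (f := fun z => bump m z * √(F.θ (z, t)))
    (w := fun z => F.v (z, t))
    (fun z => (hasDerivAt_bump m z).mul ((F.θ_x z t).sqrt (F.θ_pos _).ne'))
    hc' (by fun_prop) (fun z => F.v_pos _) hx (left_mem_Icc.2 (by linarith : m - 1 ≤ m + 1))
  simp only [bump_left, zero_mul, sub_zero, mul_pow, hq] at h1
  have h2 : (∫ z in (m - 1)..(m + 1), (-2 * (z - m) * √(F.θ (z, t))
      + bump m z * (F.θx (z, t) / (2 * √(F.θ (z, t))))) ^ 2 / F.v (z, t))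
      ≤ ∫ z in (m - 1)..(m + 1), (8 / c * F.θ (z, t) + 1 / 2 *
        (bump m z ^ 2 * (F.θx (z, t) ^ 2 / (F.θ (z, t) * F.v (z, t))))) := by
    apply intervalIntegral.integral_mono_on (by linarith)
    · exact ((hc'.pow 2).div (by fun_prop) fun z => (F.v_pos _).ne').intervalIntegrable _ _
    · exact Continuous.intervalIntegrable (by fun_prop) _ _
    intro z hz
    have hv := F.v_pos (z, t)
    have hθ := F.θ_pos (z, t)
    calc _ ≤ (2 * ((-2 * (z - m)) ^ 2 * √(F.θ (z, t)) ^ 2)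
          + 2 * (bump m z * (F.θx (z, t) / (2 * √(F.θ (z, t))))) ^ 2) / F.v (z, t) := by
          gcongr
          nlinarith [sq_nonneg (-2 * (z - m) * √(F.θ (z, t))
            - bump m z * (F.θx (z, t) / (2 * √(F.θ (z, t)))))]
      _ = 2 * (-2 * (z - m)) ^ 2 * (F.θ (z, t) / F.v (z, t)) + 1 / 2 *
          (bump m z ^ 2 * (F.θx (z, t) ^ 2 / (F.θ (z, t) * F.v (z, t)))) := by
          rw [mul_pow _ (_ / _), div_pow, mul_pow 2, hq]
          field_simp
      _ ≤ 2 * 4 * (F.θ (z, t) / c) + 1 / 2 *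
          (bump m z ^ 2 * (F.θx (z, t) ^ 2 / (F.θ (z, t) * F.v (z, t)))) := by
          have := hcv z
          have := deriv_bump_sq_le hz
          gcongr
      _ = _ := by ring
  rw [intervalIntegral.integral_add, intervalIntegral.integral_const_mul,
    intervalIntegral.integral_const_mul] at h2
  · have h5 := F.integral_v_le hA
    have h6 := F.integral_θ_le hA
    calc bump m x ^ 2 * F.θ (x, t) ≤ _ := h1
      _ ≤ A * (8 / c * A + 1 / 2 * F.conduction m t) := by
          apply mul_le_mul h5 (h2.trans _) _ (by linarith)
          · unfold conduction; gcongr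
          · exact intervalIntegral.integral_nonneg (by linarith) fun z _ =>
              div_nonneg (sq_nonneg _) (F.v_pos _).le
      _ = _ := by ring
  · exact Continuous.intervalIntegrable (by fun_prop) _ _
  · exact (continuous_const.mul hG).intervalIntegrable _ _

end MHDFlow

namespace MHDFlow

variable {α β T : ℝ} (F : MHDFlow α β T) {A m : ℝ}

theorem integral_power_le (hβ : 0 < β) (hβ1 : β < 1) {t : ℝ}
    (hA : ∫ x in (m - 1)..(m + 1), F.energy (x, t) ≤ A / 2 - 2) :
    ∫ x in (m - 1)..(m + 1), bump m x ^ 2 * (F.θ (x, t) ^ (1 - β) / (1 - β))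
      ≤ (2 + A) / (1 - β) := by
  have hb := continuous_bump m
  have hθc := F.cont_θ
  have hγ : 0 < 1 - β := by linarith
  have hηc : Continuous fun x => bump m x ^ 2 * (F.θ (x, t) ^ (1 - β) / (1 - β)) :=
    (hb.pow 2).mul (((F.continuous_θ_rpow _).comp
      (by fun_prop : Continuous fun x : ℝ => (x, t))).div_const _)
  have hpow : ∀ z : ℝ, 0 < z → z ^ (1 - β) ≤ 1 + z := by
    intro z hz
    rcases le_total z 1 with h | h
    · have := Real.rpow_le_one hz.le h hγ.le
      linarith
    · have := Real.rpow_le_rpow_of_exponent_le h (by linarith : 1 - β ≤ 1)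
      rw [Real.rpow_one] at this
      linarith
  calc _ ≤ ∫ x in (m - 1)..(m + 1), (1 + F.θ (x, t)) / (1 - β) := by
        apply intervalIntegral.integral_mono_on (by linarith)
        · exact hηc.intervalIntegrable _ _
        · exact Continuous.intervalIntegrable (by fun_prop) _ _
        intro x hx
        have hp := Real.rpow_pos_of_pos (F.θ_pos (x, t)) (1 - β)
        have := hpow _ (F.θ_pos (x, t))
        have := (bump_sq_mem hx).2
        calc _ ≤ 1 * (F.θ (x, t) ^ (1 - β) / (1 - β)) := by gcongr
          _ ≤ _ := by rw [one_mul]; gcongr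
    _ = (2 + ∫ x in (m - 1)..(m + 1), F.θ (x, t)) / (1 - β) := by
        rw [intervalIntegral.integral_div, intervalIntegral.integral_add,
          intervalIntegral.integral_const]
        · simp only [smul_eq_mul]; ring
        all_goals exact Continuous.intervalIntegrable (by fun_prop) _ _
    _ ≤ _ := by
        have := F.integral_θ_le hA
        gcongr

theorem continuous_localSource (m : ℝ) : Continuous (F.localSource m) := by
  have hb := continuous_bump m
  have hSc := F.continuous_powerSource
  have hq := F.cont_θx.div F.cont_v fun p => (F.v_pos p).ne'
  exact (by fun_prop : Continuous fun p : ℝ × ℝ => bump m p.1 ^ 2 * F.powerSource p).sub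
    ((by fun_prop : Continuous fun p : ℝ × ℝ => 2 * bump m p.1 * (-2 * (p.1 - m))).mul hq)

theorem le_integral_localSource (hα : 0 ≤ α) (hβ : 0 < β) {c C s : ℝ} (hc : 0 < c)
    (hA : ∫ x in (m - 1)..(m + 1), F.energy (x, s) ≤ A / 2 - 2)
    (hcv : ∀ x, c ≤ F.v (x, s)) (hC : 0 ≤ C)
    (hεC : ∀ z, 0 < z → z ^ (1 - β) ≤ 2 * β * c / A ^ 2 * z + C) :
    β / 4 * F.conduction m s - (8 * A / (β * c) + 4 * β * A / c + A * C / (4 * c))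
      ≤ ∫ x in (m - 1)..(m + 1), F.localSource m (x, s) := by
  have hb := continuous_bump m
  have hθc := F.cont_θ
  have h4 := F.four_le_of_energy_le hA
  have hG : Continuous fun z => β / 2 *
      (bump m z ^ 2 * (F.θx (z, s) ^ 2 / (F.θ (z, s) * F.v (z, s)))) :=
    continuous_const.mul ((hb.pow 2).mul
      (F.continuous_logGradient.comp (by fun_prop : Continuous fun z : ℝ => (z, s))))
  set M := 8 * A ^ 2 / c + A / 2 * F.conduction m s with hM
  have hM' : ∀ x ∈ Icc (m - 1) (m + 1), bump m x ^ 2 * F.θ (x, s) ≤ M := fun x hx =>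
    F.bump_sq_mul_θ_le hc hA hcv hx
  have hM0 : 0 ≤ M := by
    have := F.θ_pos (m, s)
    refine le_trans ?_ (hM' m ⟨by linarith, by linarith⟩)
    positivity
  set ε := 2 * β * c / A ^ 2 with hε
  set k := 8 / (β * c) + (ε * M + C) / (4 * c) with hk
  have hk0 : 0 ≤ k := by positivity
  have hkθ : Continuous fun x => k * F.θ (x, s) := by fun_prop
  calc β / 4 * F.conduction m s - _ = β / 2 * F.conduction m s - k * A := by
        rw [hk, hM, hε]; field_simp; ring
    _ ≤ β / 2 * F.conduction m s - k * ∫ x in (m - 1)..(m + 1), F.θ (x, s) := by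
        have := F.integral_θ_le hA
        gcongr
    _ = ∫ x in (m - 1)..(m + 1), (β / 2 * (bump m x ^ 2 *
          (F.θx (x, s) ^ 2 / (F.θ (x, s) * F.v (x, s)))) - k * F.θ (x, s)) := by
        rw [intervalIntegral.integral_sub (hG.intervalIntegrable _ _)
          (hkθ.intervalIntegrable _ _), intervalIntegral.integral_const_mul,
          intervalIntegral.integral_const_mul]
        rfl
    _ ≤ _ := by
        apply intervalIntegral.integral_mono_on (by linarith)
        · exact (hG.sub hkθ).intervalIntegrable _ _
        · exact ((F.continuous_localSource m).comp (by fun_prop :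
            Continuous fun x : ℝ => (x, s))).intervalIntegrable _ _
        intro x hx
        exact F.le_powerSource hα hβ (x, s) hc (hcv x) (by positivity) hC
          (hεC _ (F.θ_pos _)) (bump_sq_mem hx).2 (deriv_bump_sq_le hx) (hM' x hx)

theorem integral_conduction_le (hα : 0 ≤ α) (hβ : 0 < β) (hβ1 : β < 1) {c C : ℝ} (hc : 0 < c)
    (hA : ∀ t ∈ Icc 0 T, ∫ x in (m - 1)..(m + 1), F.energy (x, t) ≤ A / 2 - 2)
    (hcv : ∀ x, ∀ t ∈ Icc 0 T, c ≤ F.v (x, t)) (hC : 0 ≤ C)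
    (hεC : ∀ z, 0 < z → z ^ (1 - β) ≤ 2 * β * c / A ^ 2 * z + C)
    {t : ℝ} (ht : t ∈ Icc 0 T) :
    β / 4 * ∫ s in (0 : ℝ)..t, F.conduction m s
      ≤ (2 + A) / (1 - β) + T * (8 * A / (β * c) + 4 * β * A / c + A * C / (4 * c)) := by
  have h4 := F.four_le_of_energy_le (hA t ht)
  have hDc := F.continuous_conduction (m := m)
  have h1 := F.integral_power_le hβ hβ1 (hA t ht)
  have h2 : 0 ≤ ∫ x in (m - 1)..(m + 1), bump m x ^ 2 * (F.θ (x, 0) ^ (1 - β) / (1 - β)) :=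
    intervalIntegral.integral_nonneg (by linarith) fun x _ =>
      mul_nonneg (sq_nonneg _) (div_nonneg (Real.rpow_nonneg (F.θ_pos _).le _) (by linarith))
  have h3 := F.power_balance (m := m) hβ1 ht
  set Q := 8 * A / (β * c) + 4 * β * A / c + A * C / (4 * c) with hQ
  have hQ0 : 0 ≤ Q := by positivity
  have hQs := fun s hs => F.le_integral_localSource (s := s) hα hβ hc (hA s hs)
    (fun x => hcv x s hs) hC hεC
  simp only [← hQ] at hQs
  clear_value Q
  have hLc := F.continuous_localSource m
  have hfc : Continuous fun s => ∫ x in (m - 1)..(m + 1), F.localSource m (x, s) :=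
    intervalIntegral.continuous_parametric_intervalIntegral_of_continuous'
      (f := fun s x => F.localSource m (x, s)) (by fun_prop) _ _
  have h5 : ∫ s in (0 : ℝ)..t, (β / 4 * F.conduction m s - Q)
      ≤ ∫ s in (0 : ℝ)..t, ∫ x in (m - 1)..(m + 1), F.localSource m (x, s) := by
    apply intervalIntegral.integral_mono_on ht.1
    · exact Continuous.intervalIntegrable (by fun_prop) _ _
    · exact hfc.intervalIntegrable _ _
    intro s hs
    exact hQs s ⟨hs.1, hs.2.trans ht.2⟩
  rw [intervalIntegral.integral_sub (Continuous.intervalIntegrable (by fun_prop) _ _)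
    (by simp), intervalIntegral.integral_const_mul, intervalIntegral.integral_const,
    smul_eq_mul, sub_zero] at h5
  have h6 : t * Q ≤ T * Q := mul_le_mul_of_nonneg_right ht.2 hQ0
  linarith

theorem exists_temperature_majorant {β A c T : ℝ} (hβ : 0 < β) (hA4 : 4 ≤ A) (hc : 0 < c) :
    ∃ B, ∀ {α : ℝ} (F : MHDFlow α β T) {m : ℝ}, 0 ≤ α →
      (∀ t ∈ Icc 0 T, ∫ x in (m - 1)..(m + 1), F.energy (x, t) ≤ A / 2 - 2) →
      (∀ t ∈ Icc 0 T, ∫ s in (0 : ℝ)..t, ∫ x in (m - 1)..(m + 1), F.dissipation (x, s) ≤ A) →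
      (∀ x, ∀ t ∈ Icc 0 T, c ≤ F.v (x, t)) →
      ∃ N : ℝ → ℝ, Continuous N ∧
        (∀ s ∈ Icc 0 T, ∀ x ∈ Icc (m - 1) (m + 1), bump m x ^ 2 * F.θ (x, s) ≤ N s) ∧
        ∀ t ∈ Icc 0 T, ∫ s in (0 : ℝ)..t, N s ≤ B := by
  rcases le_or_gt 1 β with h | h
  · refine ⟨T * (1 + 2 * A ^ β) + β ^ 2 / 2 * A * A, fun F m hα hA hD hcv => ?_⟩
    have hDc := F.continuous_dissipation
    have hDi : Continuous fun s => ∫ z in (m - 1)..(m + 1), F.dissipation (z, s) :=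
      intervalIntegral.continuous_parametric_intervalIntegral_of_continuous'
        (f := fun s z => F.dissipation (z, s)) (by fun_prop) _ _
    refine ⟨fun s => 1 + 2 * A ^ β
      + β ^ 2 / 2 * A * ∫ z in (m - 1)..(m + 1), F.dissipation (z, s), by fun_prop,
      fun s hs x hx => ?_, fun t ht => ?_⟩
    · refine le_trans ?_ (F.θ_le_of_one_le hα h hx (hA s hs))
      exact mul_le_of_le_one_left (F.θ_pos _).le (bump_sq_mem hx).2
    · rw [intervalIntegral.integral_add, intervalIntegral.integral_const_mul,
        intervalIntegral.integral_const]
      · simp only [smul_eq_mul, sub_zero]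
        have := hD t ht
        have := ht.2
        have : 0 ≤ A ^ β := Real.rpow_nonneg (by linarith) _
        gcongr
      all_goals exact Continuous.intervalIntegrable (by fun_prop) _ _
  · obtain ⟨C, hC, hεC⟩ := exists_rpow_le_mul_add hβ h
      (by positivity : 0 < 2 * β * c / A ^ 2)
    refine ⟨T * (8 * A ^ 2 / c) + A / 2 * (4 / β * ((2 + A) / (1 - β)
      + T * (8 * A / (β * c) + 4 * β * A / c + A * C / (4 * c)))),
      fun F m hα hA hD hcv => ?_⟩
    have hDc := F.continuous_conduction (m := m)
    refine ⟨fun s => 8 * A ^ 2 / c + A / 2 * F.conduction m s, by fun_prop,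
      fun s hs x hx => F.bump_sq_mul_θ_le hc (hA s hs) (fun x => hcv x s hs) hx, fun t ht => ?_⟩
    rw [intervalIntegral.integral_add, intervalIntegral.integral_const_mul,
      intervalIntegral.integral_const]
    · simp only [smul_eq_mul, sub_zero]
      have h1 := F.integral_conduction_le hα hβ h hc hA hcv hC hεC ht
      have := ht.2
      have h2 : ∫ s in (0 : ℝ)..t, F.conduction m s = 4 / β * (β / 4 *
        ∫ s in (0 : ℝ)..t, F.conduction m s) := by field_simp
      rw [h2]
      gcongr
    all_goals exact Continuous.intervalIntegrable (by fun_prop) _ _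

/-- Squared length of the transverse magnetic field. -/
def magnetic (p : ℝ × ℝ) : ℝ := F.b₁ p ^ 2 + F.b₂ p ^ 2

theorem continuous_magnetic : Continuous F.magnetic :=
  (F.cont_b₁.pow 2).add (F.cont_b₂.pow 2)

theorem magnetic_nonneg (p) : 0 ≤ F.magnetic p := by unfold magnetic; positivity

theorem magnetic_le (hα : 0 ≤ α) {c t N : ℝ} (hc : 0 < c)
    (hA : ∫ x in (m - 1)..(m + 1), F.energy (x, t) ≤ A / 2 - 2)
    (hcv : ∀ x, c ≤ F.v (x, t))
    (hN : ∀ x ∈ Icc (m - 1) (m + 1), bump m x ^ 2 * F.θ (x, t) ≤ N) :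
    F.magnetic (m, t) ≤ 4 * A / c + N * A
      + ∫ x in (m - 1)..(m + 1), F.dissipation (x, t) := by
  have hb := continuous_bump m
  have hb₁ := F.cont_b₁
  have hb₂ := F.cont_b₂
  have hb₁x := F.cont_b₁x
  have hb₂x := F.cont_b₂x
  have hvc := F.cont_v
  have hDc := F.continuous_dissipation
  have hMc := F.continuous_magnetic
  have hd : ∀ x, HasDerivAt (fun x => bump m x ^ 2 * F.magnetic (x, t))
      (2 * bump m x * (-2 * (x - m)) * F.magnetic (x, t)
        + bump m x ^ 2 * (2 * (F.b₁ (x, t) * F.b₁x (x, t) + F.b₂ (x, t) * F.b₂x (x, t)))) x := by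
    intro x
    refine (((hasDerivAt_bump m x).pow 2).mul
      (((F.b₁_x x t).pow 2).add ((F.b₂_x x t).pow 2))).congr_deriv ?_
    simp only [magnetic, Pi.add_apply, Pi.pow_apply, Nat.add_one_sub_one, Nat.cast_ofNat, pow_one]
    ring
  have h1 := abs_sub_le_integral_abs_deriv hd (by fun_prop)
    (x := m) (y := m - 1) (a := m - 1) (b := m + 1) ⟨by linarith, by linarith⟩
    ⟨by linarith, by linarith⟩
  simp only [bump_self, bump_left, one_pow, one_mul, ne_eq, OfNat.ofNat_ne_zero,
    not_false_eq_true, zero_pow, zero_mul, sub_zero] at h1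
  rw [abs_of_nonneg (F.magnetic_nonneg _)] at h1
  have h4 := F.four_le_of_energy_le hA
  have hmag := F.integral_magnetic_le hA
  have hN0 : 0 ≤ N := by
    refine le_trans ?_ (hN m ⟨by linarith, by linarith⟩)
    have := F.θ_pos (m, t)
    positivity
  calc F.magnetic (m, t) ≤ _ := h1
    _ ≤ ∫ x in (m - 1)..(m + 1), ((4 / c + N) * (F.v (x, t) *
        (F.b₁ (x, t) ^ 2 + F.b₂ (x, t) ^ 2)) + F.dissipation (x, t)) := by
        apply intervalIntegral.integral_mono_on (by linarith)
        · exact Continuous.intervalIntegrable (by fun_prop) _ _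
        · exact Continuous.intervalIntegrable (by fun_prop) _ _
        intro x hx
        have hv := F.v_pos (x, t)
        have hθ := F.θ_pos (x, t)
        have hμ := F.μ_ge_one hα (x, t)
        obtain ⟨hφ0, hφ1⟩ := bump_sq_mem hx
        have hM := F.magnetic_nonneg (x, t)
        have hMv : F.magnetic (x, t) ≤ F.v (x, t) * F.magnetic (x, t) / c := by
          rw [le_div_iff₀ hc, mul_comm]
          exact mul_le_mul_of_nonneg_right (hcv x) hM
        have k1 : |2 * bump m x * (-2 * (x - m)) * F.magnetic (x, t)|
            ≤ 4 * F.magnetic (x, t) := by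
          rw [abs_mul, abs_of_nonneg hM]
          gcongr
          rw [← Real.sqrt_sq (by norm_num : (0 : ℝ) ≤ 4)]
          refine Real.abs_le_sqrt ?_
          have := deriv_bump_sq_le hx
          nlinarith
        have k2 : |bump m x ^ 2 * (2 * (F.b₁ (x, t) * F.b₁x (x, t)
            + F.b₂ (x, t) * F.b₂x (x, t)))|
            ≤ (F.b₁x (x, t) ^ 2 + F.b₂x (x, t) ^ 2) / (F.v (x, t) * F.θ (x, t))
              + bump m x ^ 2 * (bump m x ^ 2 * F.θ (x, t)) *
                (F.v (x, t) * F.magnetic (x, t)) := by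
          have e1 : (F.b₁x (x, t) ^ 2 + F.b₂x (x, t) ^ 2) / (F.v (x, t) * F.θ (x, t))
              + bump m x ^ 2 * (bump m x ^ 2 * F.θ (x, t)) * (F.v (x, t) * F.magnetic (x, t))
              + bump m x ^ 2 * (2 * (F.b₁ (x, t) * F.b₁x (x, t) + F.b₂ (x, t) * F.b₂x (x, t)))
              = 1 / (F.v (x, t) * F.θ (x, t)) *
                ((F.b₁x (x, t) + bump m x ^ 2 * F.θ (x, t) * F.v (x, t) * F.b₁ (x, t)) ^ 2
                + (F.b₂x (x, t) + bump m x ^ 2 * F.θ (x, t) * F.v (x, t) * F.b₂ (x, t)) ^ 2) := by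
            unfold magnetic; field_simp; ring
          have e2 : (F.b₁x (x, t) ^ 2 + F.b₂x (x, t) ^ 2) / (F.v (x, t) * F.θ (x, t))
              + bump m x ^ 2 * (bump m x ^ 2 * F.θ (x, t)) * (F.v (x, t) * F.magnetic (x, t))
              - bump m x ^ 2 * (2 * (F.b₁ (x, t) * F.b₁x (x, t) + F.b₂ (x, t) * F.b₂x (x, t)))
              = 1 / (F.v (x, t) * F.θ (x, t)) *
                ((F.b₁x (x, t) - bump m x ^ 2 * F.θ (x, t) * F.v (x, t) * F.b₁ (x, t)) ^ 2
                + (F.b₂x (x, t) - bump m x ^ 2 * F.θ (x, t) * F.v (x, t) * F.b₂ (x, t)) ^ 2) := by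
            unfold magnetic; field_simp; ring
          have p1 : 0 ≤ 1 / (F.v (x, t) * F.θ (x, t)) *
                ((F.b₁x (x, t) + bump m x ^ 2 * F.θ (x, t) * F.v (x, t) * F.b₁ (x, t)) ^ 2
                + (F.b₂x (x, t) + bump m x ^ 2 * F.θ (x, t) * F.v (x, t) * F.b₂ (x, t)) ^ 2) := by
            positivity
          have p2 : 0 ≤ 1 / (F.v (x, t) * F.θ (x, t)) *
                ((F.b₁x (x, t) - bump m x ^ 2 * F.θ (x, t) * F.v (x, t) * F.b₁ (x, t)) ^ 2
                + (F.b₂x (x, t) - bump m x ^ 2 * F.θ (x, t) * F.v (x, t) * F.b₂ (x, t)) ^ 2) := by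
            positivity
          rw [abs_le]
          constructor <;> linarith
        have k3 : bump m x ^ 2 * (bump m x ^ 2 * F.θ (x, t)) * (F.v (x, t) * F.magnetic (x, t))
            ≤ N * (F.v (x, t) * F.magnetic (x, t)) := by
          gcongr
          calc _ ≤ 1 * N := by gcongr; exact hN x hx
            _ = N := one_mul _
        have k4 : (F.b₁x (x, t) ^ 2 + F.b₂x (x, t) ^ 2) / (F.v (x, t) * F.θ (x, t))
            ≤ F.dissipation (x, t) := by
          have q1 : 0 ≤ F.θ (x, t) ^ β * F.θx (x, t) ^ 2 / (F.v (x, t) * F.θ (x, t) ^ 2) := by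
            positivity
          have q2 : (F.b₁x (x, t) ^ 2 + F.b₂x (x, t) ^ 2) / (F.v (x, t) * F.θ (x, t))
              ≤ F.heating (x, t) / (F.v (x, t) * F.θ (x, t)) := by
            gcongr
            unfold heating
            have : 0 ≤ F.μ (x, t) * F.ux (x, t) ^ 2 := by positivity
            nlinarith [sq_nonneg (F.w₁x (x, t)), sq_nonneg (F.w₂x (x, t))]
          unfold dissipation
          linarith
        refine (abs_add_le _ _).trans ?_
        have e : (4 / c + N) * (F.v (x, t) * (F.b₁ (x, t) ^ 2 + F.b₂ (x, t) ^ 2))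
            = 4 * (F.v (x, t) * F.magnetic (x, t) / c) + N * (F.v (x, t) * F.magnetic (x, t)) := by
          unfold magnetic; ring
        rw [e]
        linarith
    _ = (4 / c + N) * (∫ x in (m - 1)..(m + 1), F.v (x, t) *
          (F.b₁ (x, t) ^ 2 + F.b₂ (x, t) ^ 2))
        + ∫ x in (m - 1)..(m + 1), F.dissipation (x, t) := by
        rw [intervalIntegral.integral_add, intervalIntegral.integral_const_mul]
        all_goals exact Continuous.intervalIntegrable (by fun_prop) _ _
    _ ≤ (4 / c + N) * A + ∫ x in (m - 1)..(m + 1), F.dissipation (x, t) := by gcongr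
    _ = _ := by ring

end MHDFlow

namespace MHDFlow

theorem load_le {α β T : ℝ} (F : MHDFlow α β T) {A B c m t : ℝ} {N : ℝ → ℝ} (hα : 0 ≤ α)
    (hc : 0 < c)
    (hA : ∀ t ∈ Icc 0 T, ∫ x in (m - 1)..(m + 1), F.energy (x, t) ≤ A / 2 - 2)
    (hD : ∀ t ∈ Icc 0 T, ∫ s in (0 : ℝ)..t, ∫ x in (m - 1)..(m + 1), F.dissipation (x, s) ≤ A)
    (hcv : ∀ x, ∀ t ∈ Icc 0 T, c ≤ F.v (x, t)) (hNc : Continuous N)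
    (hN : ∀ s ∈ Icc 0 T, ∀ x ∈ Icc (m - 1) (m + 1), bump m x ^ 2 * F.θ (x, s) ≤ N s)
    (hB : ∀ t ∈ Icc 0 T, ∫ s in (0 : ℝ)..t, N s ≤ B) (ht : t ∈ Icc 0 T) :
    F.load (m, t) ≤ (1 / c + A / 2) * B + T * (2 * A / c) + A / 2 := by
  have h4 := F.four_le_of_energy_le (hA t ht)
  have hp := F.continuous_pressure
  have hDc := F.continuous_dissipation
  have hDi : Continuous fun s => ∫ z in (m - 1)..(m + 1), F.dissipation (z, s) :=
    intervalIntegral.continuous_parametric_intervalIntegral_of_continuous'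
      (f := fun s z => F.dissipation (z, s)) (by fun_prop) _ _
  calc F.load (m, t) ≤ ∫ s in (0 : ℝ)..t, ((1 / c + A / 2) * N s + 2 * A / c
        + 1 / 2 * ∫ x in (m - 1)..(m + 1), F.dissipation (x, s)) := by
        apply intervalIntegral.integral_mono_on ht.1
        · exact Continuous.intervalIntegrable (by fun_prop) _ _
        · exact Continuous.intervalIntegrable (by fun_prop) _ _
        intro s hs
        have hs' : s ∈ Icc 0 T := ⟨hs.1, hs.2.trans ht.2⟩
        have h1 := F.magnetic_le hα hc (hA s hs') (fun x => hcv x s hs') (hN s hs')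
        have h2 := hN s hs' m ⟨by linarith, by linarith⟩
        rw [bump_self, one_pow, one_mul] at h2
        have hθ := F.θ_pos (m, s)
        have h3 : F.θ (m, s) / F.v (m, s) ≤ N s / c :=
          div_le_div₀ (hθ.le.trans h2) h2 hc (hcv m s hs')
        have e : F.pressure (m, s) = F.θ (m, s) / F.v (m, s) + F.magnetic (m, s) / 2 := rfl
        have e2 : (1 / c + A / 2) * N s + 2 * A / c
            + 1 / 2 * (∫ x in (m - 1)..(m + 1), F.dissipation (x, s))
            = N s / c + (4 * A / c + N s * A
              + ∫ x in (m - 1)..(m + 1), F.dissipation (x, s)) / 2 := by ring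
        simp only
        rw [e, e2]
        linarith
    _ = (1 / c + A / 2) * (∫ s in (0 : ℝ)..t, N s) + t * (2 * A / c)
        + 1 / 2 * ∫ s in (0 : ℝ)..t, ∫ x in (m - 1)..(m + 1), F.dissipation (x, s) := by
        rw [intervalIntegral.integral_add, intervalIntegral.integral_add,
          intervalIntegral.integral_const_mul, intervalIntegral.integral_const_mul,
          intervalIntegral.integral_const]
        · simp only [smul_eq_mul, sub_zero]
        all_goals exact Continuous.intervalIntegrable (by fun_prop) _ _
    _ ≤ (1 / c + A / 2) * B + T * (2 * A / c) + 1 / 2 * A := by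
        have := hB t ht
        have := hD t ht
        have := ht.2
        gcongr
    _ = _ := by ring

theorem impulse_le {α β T : ℝ} (F : MHDFlow α β T) {A c₀ m t : ℝ}
    (hA : ∀ t ∈ Icc 0 T, ∫ x in (m - 1)..(m + 1), F.energy (x, t) ≤ A / 2 - 2)
    (h₀ : ∀ x, c₀ ≤ F.potential (x, 0)) (ht : t ∈ Icc 0 T) :
    F.impulse (m, t) ≤ 3 * A - c₀ := by
  have hv := F.cont_v
  have h1 : ∫ x in (m - 1)..(m + 1), (c₀ + F.impulse (m, t) - 2 * A)
      ≤ ∫ x in (m - 1)..(m + 1), F.v (x, t) := by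
    apply intervalIntegral.integral_mono_on (by linarith) (by simp)
    · exact Continuous.intervalIntegrable (by fun_prop) _ _
    intro x hx
    have h2 := F.potential_le_log (x, t)
    have h3 := Real.log_le_sub_one_of_pos (F.v_pos (x, t))
    have h5 := F.load_eq x ht
    have h6 : 0 ≤ F.load (x, t) :=
      intervalIntegral.integral_nonneg ht.1 fun s _ => F.pressure_nonneg _
    have h7 := (F.impulse_bounds hA hx ht).1
    linarith [h₀ x]
  rw [intervalIntegral.integral_const, smul_eq_mul] at h1
  linarith [F.integral_v_le (hA t ht), F.four_le_of_energy_le (hA t ht)]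

theorem exists_v_bounds {α β T A V c₀ : ℝ} (hα : 0 ≤ α) (hβ : 0 < β) (hA4 : 4 ≤ A) :
    ∃ C, 1 ≤ C ∧ ∀ F : MHDFlow α β T,
      (∀ m, ∀ t ∈ Icc 0 T, ∫ x in (m - 1)..(m + 1), F.energy (x, t) ≤ A / 2 - 2) →
      (∀ m, ∀ t ∈ Icc 0 T,
        ∫ s in (0 : ℝ)..t, ∫ x in (m - 1)..(m + 1), F.dissipation (x, s) ≤ A) →
      (∀ x, F.potential (x, 0) ≤ V) → (∀ x, c₀ ≤ F.potential (x, 0)) →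
      ∀ x, ∀ t ∈ Icc 0 T, C⁻¹ ≤ F.v (x, t) ∧ F.v (x, t) ≤ C := by
  set c := Real.exp c₀ / impulseBound α T A V c₀ with hc
  have hc0 : 0 < c := div_pos (Real.exp_pos _) (impulseBound_pos _ _ _ _ _)
  obtain ⟨B, hB⟩ := exists_temperature_majorant (T := T) hβ hA4 hc0
  set L := V + (3 * A - c₀) + ((1 / c + A / 2) * B + T * (2 * A / c) + A / 2) + c ^ (-α) with hL
  refine ⟨max 1 (max c⁻¹ (Real.exp L)), le_max_left _ _, fun F hA hD hV h₀ m t ht => ?_⟩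
  have hcv : ∀ x, ∀ t ∈ Icc 0 T, c ≤ F.v (x, t) := fun x t ht =>
    F.exp_div_impulseBound_le hα (hA x) hV h₀ ht
  have hv := F.v_pos (m, t)
  constructor
  · refine (inv_le_of_inv_le₀ hc0 ?_).trans (hcv m t ht)
    exact (le_max_left _ _).trans (le_max_right _ _)
  · obtain ⟨N, hNc, hN, hNB⟩ := hB F hα (hA m) (hD m) hcv
    have h1 := F.load_le hα hc0 (hA m) (hD m) hcv hNc hN hNB ht
    have h2 := F.impulse_le (hA m) h₀ ht
    have h3 := F.load_eq m ht
    have h5 : F.v (m, t) ^ (-α) ≤ c ^ (-α) :=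
      Real.rpow_le_rpow_of_nonpos hc0 (hcv m t ht) (by linarith)
    have h6 : Real.log (F.v (m, t)) = F.potential (m, t) + F.v (m, t) ^ (-α) := by
      unfold potential; ring
    have h7 := hV m
    refine le_trans ?_ ((le_max_right _ _).trans (le_max_right _ _))
    rw [← Real.log_le_iff_le_exp hv, hL]
    linarith

end MHDFlow

/-! ### From classical solutions to flows -/

/-- The nearest point of `[0, T]`. -/
def clampTime (T t : ℝ) : ℝ := max 0 (min t T)

theorem continuous_clampTime (T : ℝ) : Continuous (clampTime T) := by
  unfold clampTime; fun_prop

theorem clampTime_mem {T : ℝ} (hT : 0 ≤ T) (t : ℝ) : clampTime T t ∈ Icc 0 T :=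
  ⟨le_max_left _ _, max_le hT (min_le_right _ _)⟩

theorem clampTime_of_mem {T t : ℝ} (ht : t ∈ Icc 0 T) : clampTime T t = t := by
  rw [clampTime, min_eq_left ht.2, max_eq_right ht.1]

theorem ContinuousOn.continuous_clampTime {E : Type*} [TopologicalSpace E] {T : ℝ} (hT : 0 ≤ T)
    {f : ℝ × ℝ → E} (hf : ContinuousOn f (univ ×ˢ Icc 0 T)) :
    Continuous fun p : ℝ × ℝ => f (p.1, clampTime T p.2) := by
  refine hf.comp_continuous ?_ fun p => ⟨mem_univ _, clampTime_mem hT _⟩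
  exact continuous_fst.prodMk ((_root_.continuous_clampTime T).comp continuous_snd)

theorem hasDerivAt_clampTime {E : Type*} [NormedAddCommGroup E] [NormedSpace ℝ E] {T t : ℝ}
    {f : ℝ → E} (ht : t ∈ Ioo 0 T) (hf : DifferentiableWithinAt ℝ f (Icc 0 T) t) :
    HasDerivAt (fun s => f (clampTime T s)) (derivWithin f (Icc 0 T) (clampTime T t)) t := by
  rw [clampTime_of_mem (Ioo_subset_Icc_self ht)]
  have hn : Icc 0 T ∈ nhds t := Icc_mem_nhds ht.1 ht.2
  refine (hf.hasDerivWithinAt.hasDerivAt hn).congr_of_eventuallyEq ?_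
  filter_upwards [hn] with s hs
  rw [clampTime_of_mem hs]

theorem HasDerivAt.fst_comp {f : ℝ → ℝ × ℝ} {f' : ℝ × ℝ} {x : ℝ} (h : HasDerivAt f f' x) :
    HasDerivAt (fun y => (f y).1) f'.1 x :=
  (ContinuousLinearMap.fst ℝ ℝ ℝ).hasFDerivAt.comp_hasDerivAt x h

theorem HasDerivAt.snd_comp {f : ℝ → ℝ × ℝ} {f' : ℝ × ℝ} {x : ℝ} (h : HasDerivAt f f' x) :
    HasDerivAt (fun y => (f y).2) f'.2 x :=
  (ContinuousLinearMap.snd ℝ ℝ ℝ).hasFDerivAt.comp_hasDerivAt x h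

namespace IsClassicalSolution

variable {α β T : ℝ} {v u θ : ℝ → ℝ → ℝ} {w b : ℝ → ℝ → ℝ × ℝ}

theorem hasDerivAt_stress (h : IsClassicalSolution α β T v u θ w b) {x t : ℝ}
    (ht : t ∈ Icc 0 T) :
    HasDerivAt (fun y => visc α (v y t) * pdx u y t / v y t
      - (θ y t / v y t + ((b y t).1 ^ 2 + (b y t).2 ^ 2) / 2)) (pdt T u x t) x := by
  obtain ⟨hv, hu, hθ, hw, hb⟩ := h.diff_x x t ht
  obtain ⟨hux, hθx, hwx, hbx⟩ := h.diff_xx x t ht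
  have hv0 := (h.v_pos x t ht).ne'
  have h1 : DifferentiableAt ℝ (fun y => visc α (v y t) * pdx u y t / v y t) x := by
    refine DifferentiableAt.div (DifferentiableAt.mul ?_ hux) hv hv0
    unfold visc
    exact (differentiableAt_const _).add
      ((differentiableAt_const _).mul (hv.rpow_const (Or.inl hv0)))
  have h2 : DifferentiableAt ℝ (fun y => θ y t / v y t + sq2 (b y t) / 2) x := by
    unfold sq2
    exact (hθ.div hv hv0).add (((hb.hasDerivAt.fst_comp.differentiableAt.pow 2).add
      (hb.hasDerivAt.snd_comp.differentiableAt.pow 2)).div_const 2)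
  have h3 := h1.hasDerivAt.sub h2.hasDerivAt
  have h4 := h.eq_mom x t ht
  refine h3.congr_deriv ?_
  rw [← eq_sub_iff_add_eq] at h4
  exact h4.symm

theorem hasDerivAt_transverse (h : IsClassicalSolution α β T v u θ w b) {x t : ℝ}
    (ht : t ∈ Icc 0 T) :
    HasDerivAt (fun y => (v y t)⁻¹ • pdx w y t) (pdt T w x t - pdx b x t) x := by
  obtain ⟨hv, -⟩ := h.diff_x x t ht
  obtain ⟨-, -, hwx, -⟩ := h.diff_xx x t ht
  have h1 : DifferentiableAt ℝ (fun y => (v y t)⁻¹ • pdx w y t) x :=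
    (hv.inv (h.v_pos x t ht).ne').smul hwx
  exact h1.hasDerivAt.congr_deriv (h.eq_w x t ht).symm

theorem hasDerivAt_induction (h : IsClassicalSolution α β T v u θ w b) {x t : ℝ}
    (hT : 0 < T) (ht : t ∈ Icc 0 T) :
    HasDerivAt (fun y => (v y t)⁻¹ • pdx b y t)
      (pdx u x t • b x t + v x t • pdt T b x t - pdx w x t) x := by
  obtain ⟨hv, -⟩ := h.diff_x x t ht
  obtain ⟨-, -, -, hbx⟩ := h.diff_xx x t ht
  obtain ⟨hvt, -, -, -, hbt⟩ := h.diff_t x t ht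
  have h1 : DifferentiableAt ℝ (fun y => (v y t)⁻¹ • pdx b y t) x :=
    (hv.inv (h.v_pos x t ht).ne').smul hbx
  refine h1.hasDerivAt.congr_deriv ?_
  have h2 : pdt T (fun y s => v y s • b y s) x t
      = pdx u x t • b x t + v x t • pdt T b x t := by
    have h3 := (hvt.hasDerivWithinAt.smul hbt.hasDerivWithinAt).derivWithin
      (uniqueDiffOn_Icc hT t ht)
    rw [← h.eq_mass x t ht, add_comm]
    exact h3
  rw [← h2]
  exact (h.eq_b x t ht).symm

theorem hasDerivAt_heatFlux (h : IsClassicalSolution α β T v u θ w b) {x t : ℝ}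
    (ht : t ∈ Icc 0 T) :
    HasDerivAt (fun y => θ y t ^ β * pdx θ y t / v y t)
      (pdt T θ x t + θ x t / v x t * pdx u x t - (visc α (v x t) * pdx u x t ^ 2
        + (pdx w x t).1 ^ 2 + (pdx w x t).2 ^ 2 + (pdx b x t).1 ^ 2 + (pdx b x t).2 ^ 2)
        / v x t) x := by
  obtain ⟨hv, -, hθ, -⟩ := h.diff_x x t ht
  obtain ⟨-, hθx, -⟩ := h.diff_xx x t ht
  have h1 : DifferentiableAt ℝ (fun y => θ y t ^ β * pdx θ y t / v y t) x :=
    ((hθ.rpow_const (Or.inl (h.θ_pos x t ht).ne')).mul hθx).div hv (h.v_pos x t ht).ne'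
  refine h1.hasDerivAt.congr_deriv ?_
  have h2 := h.eq_temp x t ht
  simp only [sq2] at h2
  rw [h2, ← add_assoc, ← add_assoc]
  exact (add_sub_cancel_right _ _).symm

/-- The flow given by a classical solution. -/
def toFlow (h : IsClassicalSolution α β T v u θ w b) (hT : 0 < T) : MHDFlow α β T where
  v p := v p.1 (clampTime T p.2)
  u p := u p.1 (clampTime T p.2)
  θ p := θ p.1 (clampTime T p.2)
  w₁ p := (w p.1 (clampTime T p.2)).1
  w₂ p := (w p.1 (clampTime T p.2)).2
  b₁ p := (b p.1 (clampTime T p.2)).1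
  b₂ p := (b p.1 (clampTime T p.2)).2
  ux p := pdx u p.1 (clampTime T p.2)
  θx p := pdx θ p.1 (clampTime T p.2)
  w₁x p := (pdx w p.1 (clampTime T p.2)).1
  w₂x p := (pdx w p.1 (clampTime T p.2)).2
  b₁x p := (pdx b p.1 (clampTime T p.2)).1
  b₂x p := (pdx b p.1 (clampTime T p.2)).2
  ut p := pdt T u p.1 (clampTime T p.2)
  θt p := pdt T θ p.1 (clampTime T p.2)
  w₁t p := (pdt T w p.1 (clampTime T p.2)).1
  w₂t p := (pdt T w p.1 (clampTime T p.2)).2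
  b₁t p := (pdt T b p.1 (clampTime T p.2)).1
  b₂t p := (pdt T b p.1 (clampTime T p.2)).2
  v_pos p := h.v_pos _ _ (clampTime_mem hT.le _)
  θ_pos p := h.θ_pos _ _ (clampTime_mem hT.le _)
  cont_v := (h.cont.continuous_clampTime hT.le).fst
  cont_u := (h.cont.continuous_clampTime hT.le).snd.fst
  cont_θ := (h.cont.continuous_clampTime hT.le).snd.snd.fst
  cont_w₁ := (h.cont.continuous_clampTime hT.le).snd.snd.snd.fst.fst
  cont_w₂ := (h.cont.continuous_clampTime hT.le).snd.snd.snd.fst.snd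
  cont_b₁ := (h.cont.continuous_clampTime hT.le).snd.snd.snd.snd.fst
  cont_b₂ := (h.cont.continuous_clampTime hT.le).snd.snd.snd.snd.snd
  cont_ux := (h.cont_dx.continuous_clampTime hT.le).snd.fst
  cont_θx := (h.cont_dx.continuous_clampTime hT.le).snd.snd.fst
  cont_w₁x := (h.cont_dx.continuous_clampTime hT.le).snd.snd.snd.fst.fst
  cont_w₂x := (h.cont_dx.continuous_clampTime hT.le).snd.snd.snd.fst.snd
  cont_b₁x := (h.cont_dx.continuous_clampTime hT.le).snd.snd.snd.snd.fst
  cont_b₂x := (h.cont_dx.continuous_clampTime hT.le).snd.snd.snd.snd.snd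
  cont_ut := (h.cont_dt.continuous_clampTime hT.le).snd.fst
  cont_θt := (h.cont_dt.continuous_clampTime hT.le).snd.snd.fst
  cont_w₁t := (h.cont_dt.continuous_clampTime hT.le).snd.snd.snd.fst.fst
  cont_w₂t := (h.cont_dt.continuous_clampTime hT.le).snd.snd.snd.fst.snd
  cont_b₁t := (h.cont_dt.continuous_clampTime hT.le).snd.snd.snd.snd.fst
  cont_b₂t := (h.cont_dt.continuous_clampTime hT.le).snd.snd.snd.snd.snd
  u_x x t := (h.diff_x x _ (clampTime_mem hT.le t)).2.1.hasDerivAt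
  θ_x x t := (h.diff_x x _ (clampTime_mem hT.le t)).2.2.1.hasDerivAt
  w₁_x x t := (h.diff_x x _ (clampTime_mem hT.le t)).2.2.2.1.hasDerivAt.fst_comp
  w₂_x x t := (h.diff_x x _ (clampTime_mem hT.le t)).2.2.2.1.hasDerivAt.snd_comp
  b₁_x x t := (h.diff_x x _ (clampTime_mem hT.le t)).2.2.2.2.hasDerivAt.fst_comp
  b₂_x x t := (h.diff_x x _ (clampTime_mem hT.le t)).2.2.2.2.hasDerivAt.snd_comp
  v_t x t ht := (hasDerivAt_clampTime ht (h.diff_t x t (Ioo_subset_Icc_self ht)).1).congr_deriv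
    (h.eq_mass x _ (clampTime_mem hT.le t))
  u_t x t ht := hasDerivAt_clampTime ht (h.diff_t x t (Ioo_subset_Icc_self ht)).2.1
  θ_t x t ht := hasDerivAt_clampTime ht (h.diff_t x t (Ioo_subset_Icc_self ht)).2.2.1
  w₁_t x t ht :=
    (hasDerivAt_clampTime ht (h.diff_t x t (Ioo_subset_Icc_self ht)).2.2.2.1).fst_comp
  w₂_t x t ht :=
    (hasDerivAt_clampTime ht (h.diff_t x t (Ioo_subset_Icc_self ht)).2.2.2.1).snd_comp
  b₁_t x t ht :=
    (hasDerivAt_clampTime ht (h.diff_t x t (Ioo_subset_Icc_self ht)).2.2.2.2).fst_comp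
  b₂_t x t ht :=
    (hasDerivAt_clampTime ht (h.diff_t x t (Ioo_subset_Icc_self ht)).2.2.2.2).snd_comp
  momentum x t := h.hasDerivAt_stress (clampTime_mem hT.le t)
  transverse₁ x t := by
    simpa [div_eq_inv_mul] using (h.hasDerivAt_transverse (clampTime_mem hT.le t)).fst_comp
  transverse₂ x t := by
    simpa [div_eq_inv_mul] using (h.hasDerivAt_transverse (clampTime_mem hT.le t)).snd_comp
  induction₁ x t := by
    simpa [div_eq_inv_mul] using (h.hasDerivAt_induction hT (clampTime_mem hT.le t)).fst_comp
  induction₂ x t := by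
    simpa [div_eq_inv_mul] using (h.hasDerivAt_induction hT (clampTime_mem hT.le t)).snd_comp
  temperature x t := h.hasDerivAt_heatFlux (clampTime_mem hT.le t)
  farfield ε hε := by
    obtain ⟨M, hM⟩ := h.farfield ε hε
    refine ⟨M, fun x t hx => ?_⟩
    obtain ⟨h1, h2, h3, h4, h5⟩ := hM x _ (clampTime_mem hT.le t) hx
    refine ⟨h1, h2, h3, ?_, ?_, ?_, ?_⟩
    · exact (Real.abs_le_sqrt (by unfold sq2; nlinarith)).trans_lt h4
    · exact (Real.abs_le_sqrt (by unfold sq2; nlinarith)).trans_lt h4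
    · exact (Real.abs_le_sqrt (by unfold sq2; nlinarith)).trans_lt h5
    · exact (Real.abs_le_sqrt (by unfold sq2; nlinarith)).trans_lt h5

end IsClassicalSolution

/-! ### Initial data -/

theorem sq_le_integral_sq_add_sq_deriv {f f' : ℝ → ℝ} (hf : ∀ x, HasDerivAt f (f' x) x)
    (hf' : Continuous f') (hi : Integrable fun x => f x ^ 2)
    (hi' : Integrable fun x => f' x ^ 2) (h0 : Tendsto f atBot (nhds 0)) (x : ℝ) :
    f x ^ 2 ≤ ∫ y, (f y ^ 2 + f' y ^ 2) := by
  have hcf : Continuous f := continuous_iff_continuousAt.2 fun x => (hf x).continuousAt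
  have h1 : Tendsto (fun y => f y ^ 2 + ∫ z, (f z ^ 2 + f' z ^ 2)) atBot
      (nhds (0 ^ 2 + ∫ z, (f z ^ 2 + f' z ^ 2))) := (h0.pow 2).add_const _
  rw [zero_pow two_ne_zero, zero_add] at h1
  refine ge_of_tendsto h1 ?_
  filter_upwards [eventually_le_atBot x] with y hy
  have h2 : ∫ z in y..x, 2 * f z * f' z = f x ^ 2 - f y ^ 2 := by
    refine intervalIntegral.integral_eq_sub_of_hasDerivAt (f := fun z => f z ^ 2)
      (fun z _ => ?_) (Continuous.intervalIntegrable (by fun_prop) _ _)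
    exact ((hf z).pow 2).congr_deriv (by simp)
  have h3 : ∫ z in y..x, 2 * f z * f' z ≤ ∫ z in y..x, (f z ^ 2 + f' z ^ 2) := by
    refine intervalIntegral.integral_mono_on hy (Continuous.intervalIntegrable (by fun_prop) _ _)
      (Continuous.intervalIntegrable (by fun_prop) _ _) fun z _ => two_mul_le_add_sq _ _
  have h4 : ∫ z in y..x, (f z ^ 2 + f' z ^ 2) ≤ ∫ z, (f z ^ 2 + f' z ^ 2) := by
    rw [intervalIntegral.integral_of_le hy]
    exact setIntegral_le_integral (hi.add hi') (Eventually.of_forall fun z => by positivity)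
  linarith

theorem sub_log_sub_one_le {z δ : ℝ} (hδ : 0 < δ) (hz : δ ≤ z) :
    z - Real.log z - 1 ≤ (z - 1) ^ 2 / δ := by
  have hz0 : 0 < z := hδ.trans_le hz
  have h1 := Real.one_sub_inv_le_log_of_pos hz0
  have h2 : (z - 1) ^ 2 / z ≤ (z - 1) ^ 2 / δ := by gcongr
  have h3 : (z - 1) ^ 2 / z = z - 1 - (1 - z⁻¹) := by field_simp
  linarith

namespace IsClassicalSolution

variable {α β T K δ : ℝ} {v u θ : ℝ → ℝ → ℝ} {w b : ℝ → ℝ → ℝ × ℝ}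

theorem initial_v_le (h : IsClassicalSolution α β T v u θ w b) (hT : 0 < T) (hK : 0 < K)
    (h₀ : Admissible K δ v u θ w b) (x : ℝ) : v x 0 ≤ 1 + K := by
  have hm : (0 : ℝ) ∈ Icc 0 T := ⟨le_rfl, hT.le⟩
  obtain ⟨i1, i2, i3, i4, i5, i6, i7, i8, i9, i10⟩ := h.sq_int 0 hm
  have hc : Continuous fun y => pdx v y 0 := by
    have h1 := (h.cont_dx.continuous_clampTime hT.le).fst.comp
      (by fun_prop : Continuous fun y : ℝ => (y, (0 : ℝ)))
    simpa [Function.comp_def, clampTime_of_mem hm] using h1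
  have h0 : Tendsto (fun y => v y 0 - 1) atBot (nhds 0) := by
    rw [Metric.tendsto_nhds]
    intro ε hε
    obtain ⟨M, hM⟩ := h.farfield ε hε
    filter_upwards [eventually_le_atBot (-M)] with y hy
    rw [Real.dist_eq, sub_zero]
    exact (hM y 0 hm (by linarith [neg_le_abs y])).1
  have h1 := sq_le_integral_sq_add_sq_deriv
    (fun y => (h.diff_x y 0 hm).1.hasDerivAt.sub_const 1) hc i1 i6 h0 x
  have h2 : ∫ y, ((v y 0 - 1) ^ 2 + pdx v y 0 ^ 2) ≤ K ^ 2 := by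
    refine (integral_mono (i1.add i6) (((((((((i1.add i2).add i3).add i4).add i5).add i6).add
      i7).add i8).add i9).add i10) fun y => ?_).trans h₀.1
    simp only [Pi.add_apply, sq2]
    nlinarith [sq_nonneg (u y 0), sq_nonneg (θ y 0 - 1), sq_nonneg (b y 0).1,
      sq_nonneg (b y 0).2, sq_nonneg (w y 0).1, sq_nonneg (w y 0).2, sq_nonneg (pdx u y 0),
      sq_nonneg (pdx θ y 0), sq_nonneg (pdx b y 0).1, sq_nonneg (pdx b y 0).2,
      sq_nonneg (pdx w y 0).1, sq_nonneg (pdx w y 0).2]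
  have h3 := abs_le_of_sq_le_sq (h1.trans h2) hK.le
  linarith [le_abs_self (v x 0 - 1)]

theorem integral_initial_energy_le (h : IsClassicalSolution α β T v u θ w b) (hT : 0 < T)
    (hK : 0 < K) (hδ : 0 < δ) (h₀ : Admissible K δ v u θ w b) {L : ℝ} (hL : 1 ≤ L) :
    ∫ x in -L..L, (h.toFlow hT).energy (x, 0) ≤ (1 / 2 + 1 / δ + (1 + K) / 2) * K ^ 2 := by
  have hm : (0 : ℝ) ∈ Icc 0 T := ⟨le_rfl, hT.le⟩
  obtain ⟨i1, i2, i3, i4, i5, i6, i7, i8, i9, i10⟩ := h.sq_int 0 hm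
  set D : ℝ := 1 / 2 + 1 / δ + (1 + K) / 2 with hD
  have hδi : 0 < 1 / δ := by positivity
  have hD0 : 0 < D := by positivity
  let f : ℝ → ℝ := fun x => (v x 0 - 1) ^ 2 + (u x 0) ^ 2 + (θ x 0 - 1) ^ 2 + sq2 (b x 0)
    + sq2 (w x 0) + (pdx v x 0) ^ 2 + (pdx u x 0) ^ 2 + (pdx θ x 0) ^ 2
    + sq2 (pdx b x 0) + sq2 (pdx w x 0)
  have hf : Integrable f := (((((((((i1.add i2).add i3).add i4).add i5).add i6).add
      i7).add i8).add i9).add i10)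
  have hf0 : ∀ x, 0 ≤ f x := fun x => by simp only [f, sq2]; positivity
  have key : ∀ x, (h.toFlow hT).energy (x, 0) ≤ D * f x := by
    intro x
    have e1 := sub_log_sub_one_le hδ (h₀.2.1 x)
    have e2 := sub_log_sub_one_le hδ (h₀.2.2 x)
    rw [div_eq_mul_one_div] at e1 e2
    have e3 := h.initial_v_le hT hK h₀ x
    have e4 : (h.toFlow hT).energy (x, 0) = u x 0 ^ 2 / 2 + (v x 0 - Real.log (v x 0) - 1)
        + (θ x 0 - Real.log (θ x 0) - 1) + v x 0 * sq2 (b x 0) / 2 + sq2 (w x 0) / 2 := by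
      simp only [MHDFlow.energy, toFlow, clampTime_of_mem hm, sq2]
    have e5 : D * ((v x 0 - 1) ^ 2 + (u x 0) ^ 2 + (θ x 0 - 1) ^ 2 + sq2 (b x 0) + sq2 (w x 0))
        ≤ D * f x := by
      refine mul_le_mul_of_nonneg_left ?_ hD0.le
      have : 0 ≤ (pdx v x 0) ^ 2 + (pdx u x 0) ^ 2 + (pdx θ x 0) ^ 2
          + sq2 (pdx b x 0) + sq2 (pdx w x 0) := by unfold sq2; positivity
      simp only [f]; linarith
    have b0 : 0 ≤ sq2 (b x 0) := by unfold sq2; positivity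
    have w0 : 0 ≤ sq2 (w x 0) := by unfold sq2; positivity
    have e6 : v x 0 * sq2 (b x 0) ≤ (1 + K) * sq2 (b x 0) :=
      mul_le_mul_of_nonneg_right e3 b0
    have d1 : 1 / δ ≤ D := by rw [hD]; linarith
    have d2 : 1 / 2 ≤ D := by rw [hD]; linarith
    have d3 : (1 + K) / 2 ≤ D := by rw [hD]; linarith
    have g1 := mul_le_mul_of_nonneg_right d1 (sq_nonneg (v x 0 - 1))
    have g2 := mul_le_mul_of_nonneg_right d1 (sq_nonneg (θ x 0 - 1))
    have g3 := mul_le_mul_of_nonneg_right d2 (sq_nonneg (u x 0))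
    have g4 := mul_le_mul_of_nonneg_right d3 b0
    have g5 := mul_le_mul_of_nonneg_right d2 w0
    linarith
  have hLL : -L ≤ L := by linarith
  calc ∫ x in -L..L, (h.toFlow hT).energy (x, 0) ≤ ∫ x in -L..L, D * f x := by
        refine intervalIntegral.integral_mono_on hLL
          (Continuous.intervalIntegrable ?_ _ _) (hf.const_mul D).intervalIntegrable
          fun x _ => key x
        exact (h.toFlow hT).continuous_energy.comp
          (by fun_prop : Continuous fun x : ℝ => (x, (0 : ℝ)))
    _ ≤ ∫ x, D * f x := by
        rw [intervalIntegral.integral_of_le hLL]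
        exact setIntegral_le_integral (hf.const_mul D)
          (Eventually.of_forall fun x => mul_nonneg hD0.le (hf0 x))
    _ = D * ∫ x, f x := integral_const_mul _ _
    _ ≤ D * K ^ 2 := mul_le_mul_of_nonneg_left h₀.1 hD0.le

end IsClassicalSolution

/-- Lemma 2.2 of the paper: uniform upper and lower bounds for the
specific volume `v`, with a constant depending only on `T, α, β, K, δ`. -/
theorem specific_volume_bounds (α β T K δ : ℝ) (hα : 0 ≤ α) (hβ : 0 < β) (hT : 0 < T)
    (hK : 0 < K) (hδ₀ : 0 < δ) (hδ₁ : δ ≤ 1) :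
    ∃ C : ℝ, 1 ≤ C ∧
      ∀ (v u θ : ℝ → ℝ → ℝ) (w b : ℝ → ℝ → ℝ × ℝ),
        IsClassicalSolution α β T v u θ w b → Admissible K δ v u θ w b →
        ∀ x : ℝ, ∀ t ∈ Icc (0:ℝ) T, C⁻¹ ≤ v x t ∧ v x t ≤ C := by
  set E : ℝ := (1 / 2 + 1 / δ + (1 + K) / 2) * K ^ 2 with hE
  have hE0 : 0 ≤ E := by positivity
  have hm : (0 : ℝ) ∈ Icc 0 T := ⟨le_rfl, hT.le⟩
  obtain ⟨C, hC, H⟩ := MHDFlow.exists_v_bounds (α := α) (β := β) (T := T) (A := 2 * E + 4)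
    (V := K) (c₀ := Real.log δ - δ ^ (-α)) hα hβ (by linarith)
  refine ⟨C, hC, fun v u θ w b h h₀ x t ht => ?_⟩
  have hen := fun L hL => h.integral_initial_energy_le hT hK hδ₀ h₀ (L := L) hL
  have hle : ∀ m, ∀ t ∈ Icc 0 T, (∫ x in (m - 1)..(m + 1), (h.toFlow hT).energy (x, t))
      + ∫ s in (0 : ℝ)..t, ∫ x in (m - 1)..(m + 1), (h.toFlow hT).dissipation (x, s) / 2 ≤ E :=
    fun m t ht => (h.toFlow hT).energy_le hα hen (by linarith) ht
  have hv0 : ∀ x, (h.toFlow hT).v (x, 0) = v x 0 := fun x => by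
    simp only [IsClassicalSolution.toFlow, clampTime_of_mem hm]
  have hvt : (h.toFlow hT).v (x, t) = v x t := by
    simp only [IsClassicalSolution.toFlow, clampTime_of_mem ht]
  rw [← hvt]
  refine H (h.toFlow hT) (fun m t ht => ?_) (fun m t ht => ?_) (fun x => ?_) (fun x => ?_) x t ht
  · have h1 : 0 ≤ ∫ s in (0 : ℝ)..t, ∫ x in (m - 1)..(m + 1),
        (h.toFlow hT).dissipation (x, s) / 2 :=
      intervalIntegral.integral_nonneg ht.1 fun s _ =>
        intervalIntegral.integral_nonneg (by linarith) fun x _ =>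
          div_nonneg ((h.toFlow hT).dissipation_nonneg hα _) zero_le_two
    linarith [hle m t ht]
  · have h1 : 0 ≤ ∫ x in (m - 1)..(m + 1), (h.toFlow hT).energy (x, t) :=
      intervalIntegral.integral_nonneg (by linarith) fun x _ => (h.toFlow hT).energy_nonneg _
    have h2 := hle m t ht
    simp only [intervalIntegral.integral_div] at h2
    linarith
  · have h1 := (h.toFlow hT).potential_le_log (x, 0)
    have h2 := Real.log_le_sub_one_of_pos ((h.toFlow hT).v_pos (x, 0))
    have h3 := h.initial_v_le hT hK h₀ x
    rw [← hv0] at h3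
    linarith
  · have h1 : δ ≤ (h.toFlow hT).v (x, 0) := by rw [hv0]; exact h₀.2.1 x
    exact sub_le_sub (Real.log_le_log hδ₀ h1)
      (Real.rpow_le_rpow_of_nonpos hδ₀ h1 (by linarith))
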